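/- arXiv:1903.03106 — 2 statements merged into one kernel-verified Lean document; each statement's English description precedes it below -/
import Mathlib

section
/- Let r ≥ λ/2 > 0, 0 ≤ k < d, N ≥ 2^d, and let Q = {q_1,...,q_N} ⊂ E^d be a uniform contraction of P = {p_1,...,p_N} ⊂ E^d with separating value λ (Euclidean norm). Then the k-th quermassintegral satisfies W_k(conv(Q_r)) ≤ W_k(conv(P_r)), where X_r = ∪_{x∈X} B^d[x,r] is the union of Euclidean balls of radius r centered at points of X. -/
open MeasureTheory Set
open scoped Pointwise

section LineFibers

variable {E : Type*} [NormedAddCommGroup E] [InnerProductSpace ℝ E]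

/-- The set of parameters `s` for which `y + s • u` lies in `A`. -/
def lineFiber (u : E) (A : Set E) (y : (ℝ ∙ u)ᗮ) : Set ℝ := {s | (y : E) + s • u ∈ A}

/-- For a unit vector `u`, the splitting of the space as the line spanned by `u` times its
orthogonal complement. -/
noncomputable def lineSplitting [FiniteDimensional ℝ E] (u : E) (hu : ‖u‖ = 1) :
    E ≃L[ℝ] (ℝ ∙ u)ᗮ × ℝ :=
  LinearEquiv.toContinuousLinearEquiv
    { toFun := fun x => ((ℝ ∙ u)ᗮ.orthogonalProjectionOnto x, inner ℝ u x)
      invFun := fun z => (z.1 : E) + z.2 • u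
      map_add' := fun x y => by simp [inner_add_right]
      map_smul' := fun c x => by simp [inner_smul_right]
      left_inv := fun x => by
        have h := Submodule.starProjection_add_starProjection_orthogonal (K := ℝ ∙ u) x
        rw [Submodule.starProjection_unit_singleton ℝ hu] at h
        rw [add_comm] at h
        exact h
      right_inv := fun z => by
        have hz : inner ℝ u (z.1 : E) = 0 := Submodule.mem_orthogonal_singleton_iff_inner_right.1 z.1.2
        ext
        · have h1 : (ℝ ∙ u)ᗮ.orthogonalProjectionOnto u = 0 :=
            Submodule.orthogonalProjectionOnto_orthogonal_apply_eq_zero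
              (Submodule.mem_span_singleton_self u)
          simp [h1]
        · simp [inner_add_right, inner_smul_right, hz, hu] }

theorem exists_orthogonal_add_smul [FiniteDimensional ℝ E] {u : E} (hu : ‖u‖ = 1) (x : E) :
    ∃ (y : (ℝ ∙ u)ᗮ) (s : ℝ), x = y + s • u :=
  ⟨_, _, ((lineSplitting u hu).symm_apply_apply x).symm⟩

theorem orthogonal_add_smul_inj [FiniteDimensional ℝ E] {u : E} (hu : ‖u‖ = 1)
    {y y' : (ℝ ∙ u)ᗮ} {s s' : ℝ} (h : (y : E) + s • u = y' + s' • u) : y = y' ∧ s = s' := by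
  have := (lineSplitting u hu).symm.injective (a₁ := (y, s)) (a₂ := (y', s')) h
  simpa using this

theorem reflection_orthogonal_add_smul (u : E) (y : (ℝ ∙ u)ᗮ) (s : ℝ) :
    (ℝ ∙ u)ᗮ.reflection ((y : E) + s • u) = y + (-s) • u := by
  rw [map_add, map_smul, Submodule.reflection_orthogonalComplement_singleton_eq_neg,
    Submodule.reflection_mem_subspace_eq_self y.2, smul_neg, neg_smul]

theorem convex_lineFiber (u : E) {A : Set E} (hA : Convex ℝ A) (y : (ℝ ∙ u)ᗮ) :
    Convex ℝ (lineFiber u A y) := by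
  intro s hs t ht a b ha hb hab
  have := hA hs ht ha hb hab
  simp only [lineFiber, mem_ofPred_eq] at *
  convert! this using 1
  have : (y : E) = (a + b) • (y : E) := by rw [hab, one_smul]
  nth_rewrite 1 [this]
  simp only [smul_eq_mul]
  module

theorem isCompact_lineFiber {u : E} (hu : ‖u‖ = 1) {A : Set E} (hA : IsCompact A)
    (y : (ℝ ∙ u)ᗮ) : IsCompact (lineFiber u A y) := by
  have : Isometry fun s : ℝ => (y : E) + s • u := by
    refine Isometry.of_dist_eq fun a b => ?_
    rw [dist_add_left, dist_eq_norm, ← sub_smul, norm_smul, hu, mul_one, Real.dist_eq,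
      Real.norm_eq_abs]
  exact this.isClosedEmbedding.isCompact_preimage hA

theorem exists_volume_eq_lintegral_lineFiber [FiniteDimensional ℝ E] [MeasurableSpace E]
    [BorelSpace E] {u : E} (hu : ‖u‖ = 1) :
    ∃ c : ENNReal, ∀ A : Set E, MeasurableSet A →
      volume A = c * ∫⁻ y : (ℝ ∙ u)ᗮ, volume (lineFiber u A y) := by
  set e := lineSplitting u hu
  have : (Measure.map e (volume : Measure E)).IsAddHaarMeasure :=
    e.isAddHaarMeasure_map volume
  obtain ⟨c, h⟩ : ∃ c : NNReal, Measure.map e (volume : Measure E) =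
      c • (volume : Measure (ℝ ∙ u)ᗮ).prod (volume : Measure ℝ) :=
    ⟨_, Measure.isAddLeftInvariant_eq_smul _ _⟩
  refine ⟨c, fun A hA => ?_⟩
  have hm : MeasurableSet (e.symm ⁻¹' A) := e.symm.continuous.measurable hA
  have h2 : volume A = Measure.map e volume (e.symm ⁻¹' A) := by
    rw [Measure.map_apply e.continuous.measurable hm]
    congr 1
    ext x
    simp
  rw [h2, h, Measure.smul_apply, Measure.prod_apply hm]
  rfl

theorem measurable_volume_lineFiber [FiniteDimensional ℝ E] [MeasurableSpace E]
    [BorelSpace E] {u : E} (hu : ‖u‖ = 1) {A : Set E} (hA : MeasurableSet A) :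
    Measurable fun y : (ℝ ∙ u)ᗮ => volume (lineFiber u A y) :=
  measurable_measure_prodMk_left ((lineSplitting u hu).symm.continuous.measurable hA)

theorem volume_add_of_convex_of_isCompact {X Y : Set ℝ} (hX : Convex ℝ X) (hXc : IsCompact X)
    (hXn : X.Nonempty) (hY : Convex ℝ Y) (hYc : IsCompact Y) (hYn : Y.Nonempty) :
    volume (X + Y) = volume X + volume Y := by
  have hX' := eq_Icc_of_connected_compact ⟨hXn, hX.isPreconnected⟩ hXc
  have hY' := eq_Icc_of_connected_compact ⟨hYn, hY.isPreconnected⟩ hYc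
  have h1 : sInf X ≤ sSup X := by
    by_contra h
    rw [hX', Icc_eq_empty h] at hXn
    exact hXn.ne_empty rfl
  have h2 : sInf Y ≤ sSup Y := by
    by_contra h
    rw [hY', Icc_eq_empty h] at hYn
    exact hYn.ne_empty rfl
  rw [hX', hY', Icc_add_Icc h1 h2, Real.volume_Icc, Real.volume_Icc, Real.volume_Icc,
    ← ENNReal.ofReal_add (by linarith) (by linarith)]
  congr 1
  ring

end LineFibers

section SegmentsAndSymmetrals

variable {E : Type*} [NormedAddCommGroup E] [InnerProductSpace ℝ E]

theorem mem_segment_neg_self {w x : E} :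
    x ∈ segment ℝ (-w) w ↔ ∃ a ∈ Icc (-1 : ℝ) 1, x = a • w := by
  constructor
  · rintro ⟨a, b, ha, hb, hab, rfl⟩
    exact ⟨b - a, ⟨by linarith, by linarith⟩, by module⟩
  · rintro ⟨a, ⟨h1, h2⟩, rfl⟩
    exact ⟨(1 - a) / 2, (1 + a) / 2, by linarith, by linarith, by ring, by module⟩

theorem isCompact_segment (x y : E) : IsCompact (segment ℝ x y) := by
  rw [← Path.range_segment]
  exact isCompact_range (Path.segment x y).continuous

theorem lineFiber_add_segment (u : E) (K : Set E)
    {c : ℝ} (hc : 0 ≤ c) (y : (ℝ ∙ u)ᗮ) :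
    lineFiber u (K + segment ℝ (-(c • u)) (c • u)) y = lineFiber u K y + Icc (-c) c := by
  ext s
  constructor
  · rintro ⟨x, hx, z, hz, hxz⟩
    obtain ⟨a, ⟨h1, h2⟩, rfl⟩ := mem_segment_neg_self.1 hz
    refine ⟨s - a * c, ?_, a * c, ⟨by nlinarith, by nlinarith⟩, by simp⟩
    have : x = (y : E) + (s - a * c) • u := by
      rw [eq_sub_of_add_eq hxz]
      module
    rwa [this] at hx
  · rintro ⟨a, ha, b, hb, rfl⟩
    refine ⟨_, ha, b • u, ?_, ?_⟩
    · rw [mem_segment_neg_self]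
      rcases hc.eq_or_lt with rfl | hc
      · exact ⟨0, by simp, by simp [show b = 0 by simpa using hb]⟩
      · refine ⟨b / c, ⟨?_, ?_⟩, ?_⟩
        · rw [le_div_iff₀ hc]; linarith [hb.1]
        · rw [div_le_iff₀ hc]; linarith [hb.2]
        · rw [smul_smul, div_mul_cancel₀ _ hc.ne']
    · simp only
      module

/-- The volume of `K + t • [-v, v]` is an affine function of `t ≥ 0`. -/
theorem volume_add_segment [FiniteDimensional ℝ E] [MeasurableSpace E] [BorelSpace E]
    {K : Set E} (hK : IsCompact K) (hKc : Convex ℝ K) (v : E) {t : ℝ} (ht : 0 ≤ t) :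
    volume.real (K + segment ℝ (-(t • v)) (t • v)) =
      volume.real K + t * (volume.real (K + segment ℝ (-v) v) - volume.real K) := by
  rcases eq_or_ne v 0 with rfl | hv
  · simp
  have hv0 : 0 < ‖v‖ := norm_pos_iff.2 hv
  set u := ‖v‖⁻¹ • v with hu_def
  have hu : ‖u‖ = 1 := by
    rw [hu_def, norm_smul, norm_inv, norm_norm, inv_mul_cancel₀ hv0.ne']
  have hvu : v = ‖v‖ • u := by rw [hu_def, smul_smul, mul_inv_cancel₀ hv0.ne', one_smul]
  obtain ⟨c, hc⟩ := exists_volume_eq_lintegral_lineFiber hu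
  classical
  set g : (ℝ ∙ u)ᗮ → ENNReal := fun y =>
    if (lineFiber u K y).Nonempty then ENNReal.ofReal (2 * ‖v‖) else 0 with hg
  have key : ∀ t : ℝ, 0 ≤ t → volume (K + segment ℝ (-(t • v)) (t • v)) =
      volume K + ENNReal.ofReal t * (c * ∫⁻ y, g y) := by
    intro t ht
    have h1 : ∀ y, volume (lineFiber u (K + segment ℝ (-(t • v)) (t • v)) y) =
        volume (lineFiber u K y) + ENNReal.ofReal t * g y := by
      intro y
      have htv : t • v = (t * ‖v‖) • u := by
        conv_lhs => rw [hvu]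
        rw [smul_smul]
      have h0 : 0 ≤ t * ‖v‖ := by positivity
      rw [htv, lineFiber_add_segment u K h0]
      by_cases hn : (lineFiber u K y).Nonempty
      · rw [volume_add_of_convex_of_isCompact (convex_lineFiber u hKc y)
          (isCompact_lineFiber hu hK y) hn (convex_Icc _ _) isCompact_Icc
          (nonempty_Icc.2 (by linarith)), Real.volume_Icc]
        simp only [hg, hn, if_true]
        rw [← ENNReal.ofReal_mul ht]
        congr 2
        ring
      · rw [not_nonempty_iff_eq_empty.1 hn]
        simp [hg, hn]
    rw [hc _ (hK.add (isCompact_segment _ _)).measurableSet, hc _ hK.measurableSet]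
    simp_rw [h1]
    rw [lintegral_add_left (measurable_volume_lineFiber hu hK.measurableSet),
      lintegral_const_mul' _ _ ENNReal.ofReal_ne_top]
    ring
  have hD : c * ∫⁻ y, g y ≠ ⊤ := by
    have h1 := key 1 zero_le_one
    intro h
    rw [h] at h1
    simp only [ENNReal.ofReal_one, one_mul, add_top] at h1
    exact (hK.add (isCompact_segment _ _)).measure_lt_top.ne h1
  have key' : ∀ t : ℝ, 0 ≤ t → volume.real (K + segment ℝ (-(t • v)) (t • v)) =
      volume.real K + t * (c * ∫⁻ y, g y).toReal := by
    intro t ht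
    rw [measureReal_def, key t ht, ENNReal.toReal_add hK.measure_lt_top.ne
      (ENNReal.mul_ne_top ENNReal.ofReal_ne_top hD), ENNReal.toReal_mul,
      ENNReal.toReal_ofReal ht, measureReal_def]
  have h1 := key' 1 zero_le_one
  rw [one_smul, one_mul] at h1
  rw [key' t ht, h1]
  ring

/-- The Steiner symmetral of `A` with respect to the hyperplane orthogonal to `u`
(for convex `A`), described through pairs of points of `A` on a common line parallel to `u`. -/
def steinerSymmetral (u : E) (A : Set E) : Set E :=
  {z | ∃ a ∈ A, ∃ b ∈ A, a + (ℝ ∙ u)ᗮ.reflection a = b + (ℝ ∙ u)ᗮ.reflection b ∧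
    z = (1 / 2 : ℝ) • (a + (ℝ ∙ u)ᗮ.reflection b)}

theorem convex_steinerSymmetral (u : E) {A : Set E} (hA : Convex ℝ A) :
    Convex ℝ (steinerSymmetral u A) := by
  rintro _ ⟨a, ha, b, hb, hab, rfl⟩ _ ⟨a', ha', b', hb', hab', rfl⟩ s t hs ht hst
  refine ⟨s • a + t • a', hA ha ha' hs ht hst, s • b + t • b', hA hb hb' hs ht hst, ?_, ?_⟩
  · simp only [map_add, map_smul]
    rw [show s • a + t • a' + (s • (ℝ ∙ u)ᗮ.reflection a + t • (ℝ ∙ u)ᗮ.reflection a') =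
      s • (a + (ℝ ∙ u)ᗮ.reflection a) + t • (a' + (ℝ ∙ u)ᗮ.reflection a') by module, hab, hab']
    module
  · simp only [map_add, map_smul]
    module

theorem isCompact_steinerSymmetral (u : E) {A : Set E} (hA : IsCompact A) :
    IsCompact (steinerSymmetral u A) := by
  have hc : IsClosed {z : E × E |
      z.1 + (ℝ ∙ u)ᗮ.reflection z.1 = z.2 + (ℝ ∙ u)ᗮ.reflection z.2} :=
    isClosed_eq (by fun_prop) (by fun_prop)
  have h := ((hA.prod hA).inter_right hc).image
    (f := fun z : E × E => (1 / 2 : ℝ) • (z.1 + (ℝ ∙ u)ᗮ.reflection z.2)) (by fun_prop)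
  convert h using 1
  ext z
  constructor
  · rintro ⟨a, ha, b, hb, hab, rfl⟩
    exact ⟨(a, b), ⟨⟨ha, hb⟩, hab⟩, rfl⟩
  · rintro ⟨⟨a, b⟩, ⟨⟨ha, hb⟩, hab⟩, rfl⟩
    exact ⟨a, ha, b, hb, hab, rfl⟩

theorem nonempty_steinerSymmetral (u : E) {A : Set E} (hA : A.Nonempty) :
    (steinerSymmetral u A).Nonempty := by
  obtain ⟨a, ha⟩ := hA
  exact ⟨_, a, ha, a, ha, rfl, rfl⟩

theorem add_reflection_orthogonal (u : E) (y : (ℝ ∙ u)ᗮ) (s : ℝ) :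
    ((y : E) + s • u) + (ℝ ∙ u)ᗮ.reflection (y + s • u) = (2 : ℝ) • (y : E) := by
  rw [reflection_orthogonal_add_smul]
  module

theorem exists_of_mem_steinerSymmetral [FiniteDimensional ℝ E] {u : E} (hu : ‖u‖ = 1)
    {A : Set E} {z : E} (hz : z ∈ steinerSymmetral u A) :
    ∃ (y : (ℝ ∙ u)ᗮ) (s t : ℝ), (y : E) + s • u ∈ A ∧ (y : E) + t • u ∈ A ∧
      z = y + ((1 / 2 : ℝ) * (s - t)) • u := by
  obtain ⟨a, ha, b, hb, hab, rfl⟩ := hz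
  obtain ⟨y, s, rfl⟩ := exists_orthogonal_add_smul hu a
  obtain ⟨y', t, rfl⟩ := exists_orthogonal_add_smul hu b
  rw [add_reflection_orthogonal, add_reflection_orthogonal] at hab
  have : y = y' := Subtype.ext (smul_right_injective E (two_ne_zero (α := ℝ)) hab)
  subst this
  refine ⟨y, s, t, ha, hb, ?_⟩
  rw [reflection_orthogonal_add_smul]
  module

theorem mem_steinerSymmetral (u : E) {A : Set E} {y : (ℝ ∙ u)ᗮ} {s t : ℝ}
    (hs : (y : E) + s • u ∈ A) (ht : (y : E) + t • u ∈ A) :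
    (y : E) + ((1 / 2 : ℝ) * (s - t)) • u ∈ steinerSymmetral u A := by
  refine ⟨_, hs, _, ht, ?_, ?_⟩
  · rw [add_reflection_orthogonal, add_reflection_orthogonal]
  · rw [reflection_orthogonal_add_smul]
    module

theorem lineFiber_steinerSymmetral [FiniteDimensional ℝ E] {u : E} (hu : ‖u‖ = 1)
    (A : Set E) (y : (ℝ ∙ u)ᗮ) :
    lineFiber u (steinerSymmetral u A) y =
      (1 / 2 : ℝ) • (lineFiber u A y + -lineFiber u A y) := by
  ext r
  constructor
  · intro h
    obtain ⟨y', s, t, hs, ht, h⟩ := exists_of_mem_steinerSymmetral hu h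
    obtain ⟨rfl, rfl⟩ := orthogonal_add_smul_inj hu h
    refine ⟨s - t, ⟨s, hs, -t, ?_, by ring⟩, rfl⟩
    rw [Set.mem_neg, neg_neg]
    exact ht
  · rintro ⟨_, ⟨s, hs, t, ht, rfl⟩, rfl⟩
    have h := mem_steinerSymmetral u (t := -t) hs ht
    rw [sub_neg_eq_add] at h
    exact h

theorem volume_steinerSymmetral [FiniteDimensional ℝ E] [MeasurableSpace E] [BorelSpace E]
    {u : E} (hu : ‖u‖ = 1) {A : Set E} (hA : IsCompact A) (hAc : Convex ℝ A) :
    volume (steinerSymmetral u A) = volume A := by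
  obtain ⟨c, hc⟩ := exists_volume_eq_lintegral_lineFiber hu
  rw [hc _ hA.measurableSet, hc _ (isCompact_steinerSymmetral u hA).measurableSet]
  congr 2
  ext y
  rw [lineFiber_steinerSymmetral hu]
  rcases (lineFiber u A y).eq_empty_or_nonempty with hn | hn
  · simp [hn]
  have h1 := convex_lineFiber u hAc y
  have h2 := isCompact_lineFiber hu hA y
  rw [Measure.addHaar_smul, volume_add_of_convex_of_isCompact h1 h2 hn h1.neg h2.neg hn.neg,
    Measure.measure_neg, ← two_mul, ← mul_assoc, Module.finrank_self, pow_one,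
    abs_of_pos (by norm_num), one_div, ENNReal.ofReal_inv_of_pos two_pos, ENNReal.ofReal_ofNat,
    ENNReal.inv_mul_cancel two_ne_zero ENNReal.ofNat_ne_top, one_mul]

/-- Averaging inequality for the volume of a sum with a Steiner symmetral. -/
theorem volume_steinerSymmetral_add_le [FiniteDimensional ℝ E] [MeasurableSpace E]
    [BorelSpace E] {u : E} (hu : ‖u‖ = 1) {A C : Set E} (hA : IsCompact A) (hAc : Convex ℝ A)
    (hC : IsCompact C) (hCc : Convex ℝ C) :
    volume.real (steinerSymmetral u A + C) ≤
      1 / 2 * (volume.real (A + C) + volume.real ((ℝ ∙ u)ᗮ.reflection '' A + C)) := by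
  obtain ⟨c, hc⟩ := exists_volume_eq_lintegral_lineFiber hu
  have hR : IsCompact ((ℝ ∙ u)ᗮ.reflection '' A) :=
    hA.image (ℝ ∙ u)ᗮ.reflection.continuous
  have hRc : Convex ℝ ((ℝ ∙ u)ᗮ.reflection '' A) :=
    hAc.linear_image (ℝ ∙ u)ᗮ.reflection.toLinearEquiv.toLinearMap
  have key : volume (steinerSymmetral u A + C) ≤
      ENNReal.ofReal (1 / 2) * (volume (A + C) + volume ((ℝ ∙ u)ᗮ.reflection '' A + C)) := by
    rw [hc _ (hA.add hC).measurableSet, hc _ (hR.add hC).measurableSet,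
      hc _ ((isCompact_steinerSymmetral u hA).add hC).measurableSet, ← mul_add, mul_left_comm,
      ← lintegral_add_left (measurable_volume_lineFiber hu (hA.add hC).measurableSet),
      ← lintegral_const_mul' _ _ ENNReal.ofReal_ne_top]
    gcongr with y
    have hsub : lineFiber u (steinerSymmetral u A + C) y ⊆
        (1 / 2 : ℝ) • (lineFiber u (A + C) y +
          lineFiber u ((ℝ ∙ u)ᗮ.reflection '' A + C) y) := by
      rintro r ⟨z, hz, w, hw, hzw⟩
      obtain ⟨y₁, s, t, hs, ht, rfl⟩ := exists_of_mem_steinerSymmetral hu hz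
      obtain ⟨y₂, q, rfl⟩ := exists_orthogonal_add_smul hu w
      have : ((y₁ + y₂ : (ℝ ∙ u)ᗮ) : E) + ((1 / 2 : ℝ) * (s - t) + q) • u = y + r • u := by
        rw [← hzw, Submodule.coe_add]
        module
      obtain ⟨rfl, rfl⟩ := orthogonal_add_smul_inj hu this
      refine ⟨(s + q) + (-t + q), ⟨s + q, ?_, -t + q, ?_, rfl⟩, ?_⟩
      · refine ⟨_, hs, _, hw, ?_⟩
        rw [Submodule.coe_add]
        module
      · refine ⟨_, ⟨_, ht, rfl⟩, _, hw, ?_⟩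
        rw [reflection_orthogonal_add_smul, Submodule.coe_add]
        module
      · simp only [smul_eq_mul]
        ring
    rcases (lineFiber u (steinerSymmetral u A + C) y).eq_empty_or_nonempty with hn | hn
    · simp [hn]
    have hn' := (hn.mono hsub)
    have hn1 := (smul_set_nonempty.1 hn').of_add_left
    have hn2 := (smul_set_nonempty.1 hn').of_add_right
    refine (measure_mono hsub).trans ?_
    rw [Measure.addHaar_smul, volume_add_of_convex_of_isCompact
      (convex_lineFiber u (hAc.add hCc) y) (isCompact_lineFiber hu (hA.add hC) y) hn1
      (convex_lineFiber u (hRc.add hCc) y) (isCompact_lineFiber hu (hR.add hC) y) hn2,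
      Module.finrank_self, pow_one, abs_of_pos (by norm_num)]
  have h1 := (hA.add hC).measure_lt_top (μ := volume).ne
  have h2 := (hR.add hC).measure_lt_top (μ := volume).ne
  have := ENNReal.toReal_mono
    (ENNReal.mul_ne_top ENNReal.ofReal_ne_top (ENNReal.add_ne_top.2 ⟨h1, h2⟩)) key
  rwa [ENNReal.toReal_mul, ENNReal.toReal_ofReal (by norm_num), ENNReal.toReal_add h1 h2] at this

end SegmentsAndSymmetrals

section Zonotopes

variable {E : Type*} [NormedAddCommGroup E] [InnerProductSpace ℝ E]

/-- The zonotope `∑ [-v, v]` generated by a finite multiset of vectors. -/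
def zonotope (l : Multiset E) : Set E := (l.map fun v => segment ℝ (-v) v).sum

@[simp] theorem zonotope_zero : zonotope (0 : Multiset E) = 0 := by simp [zonotope]

@[simp] theorem zonotope_singleton (v : E) : zonotope {v} = segment ℝ (-v) v := by
  simp [zonotope]

theorem zonotope_add (l m : Multiset E) : zonotope (l + m) = zonotope l + zonotope m := by
  simp [zonotope]

theorem zonotope_cons (v : E) (l : Multiset E) :
    zonotope (v ::ₘ l) = segment ℝ (-v) v + zonotope l := by
  simp [zonotope]

theorem convex_zonotope (l : Multiset E) : Convex ℝ (zonotope l) := by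
  induction l using Multiset.induction with
  | empty => rw [zonotope_zero]; exact convex_singleton 0
  | cons v l ih => rw [zonotope_cons]; exact (convex_segment _ _).add ih

theorem isCompact_zonotope (l : Multiset E) : IsCompact (zonotope l) := by
  induction l using Multiset.induction with
  | empty => rw [zonotope_zero]; exact isCompact_singleton
  | cons v l ih => rw [zonotope_cons]; exact (isCompact_segment _ _).add ih

theorem neg_zonotope (l : Multiset E) : -zonotope l = zonotope l := by
  induction l using Multiset.induction with
  | empty => simp
  | cons v l ih =>
    have h : -segment ℝ (-v) v = segment ℝ (-v) v := by
      ext x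
      rw [Set.mem_neg, mem_segment_neg_self, mem_segment_neg_self]
      constructor
      · rintro ⟨a, ⟨h1, h2⟩, h⟩
        exact ⟨-a, ⟨by linarith, by linarith⟩, by rw [neg_smul, ← h, neg_neg]⟩
      · rintro ⟨a, ⟨h1, h2⟩, rfl⟩
        exact ⟨-a, ⟨by linarith, by linarith⟩, by rw [neg_smul]⟩
    rw [zonotope_cons, neg_add, ih, h]

theorem zonotope_nsmul (k : ℕ) (l : Multiset E) : zonotope (k • l) = (k : ℝ) • zonotope l := by
  induction k with
  | zero =>
    rw [zero_smul, zonotope_zero, Nat.cast_zero, zero_smul_set]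
    have h : ∀ l : Multiset E, (0 : E) ∈ zonotope l := fun l => by
      induction l using Multiset.induction with
      | empty => simp
      | cons v l ih =>
        rw [zonotope_cons]
        exact ⟨0, mem_segment_neg_self.2 ⟨0, by simp, by simp⟩, 0, ih, by simp⟩
    exact ⟨0, h l⟩
  | succ k ih =>
    rw [succ_nsmul, zonotope_add, ih, Nat.cast_succ,
      (convex_zonotope l).add_smul (by positivity) zero_le_one, one_smul]

/-- The support function of a zonotope. -/
noncomputable def zonotopeSupport (l : Multiset E) (x : E) : ℝ :=
  (l.map fun v => |inner ℝ x v|).sum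

theorem inner_le_zonotopeSupport {l : Multiset E} {y : E} (hy : y ∈ zonotope l) (x : E) :
    inner ℝ x y ≤ zonotopeSupport l x := by
  induction l using Multiset.induction generalizing y with
  | empty =>
    rw [zonotope_zero, Set.mem_zero] at hy
    simp [hy, zonotopeSupport]
  | cons v l ih =>
    rw [zonotope_cons] at hy
    obtain ⟨z, hz, w, hw, rfl⟩ := hy
    obtain ⟨a, ha, rfl⟩ := mem_segment_neg_self.1 hz
    have h1 := ih hw
    have h2 : inner ℝ x (a • v) ≤ |inner ℝ x v| := by
      rw [inner_smul_right]
      refine (le_abs_self _).trans ?_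
      rw [abs_mul]
      exact mul_le_of_le_one_left (abs_nonneg _) (abs_le.2 ha)
    simp only [zonotopeSupport, Multiset.map_cons, Multiset.sum_cons] at h1 ⊢
    rw [inner_add_right]
    exact add_le_add h2 h1

theorem exists_inner_eq_zonotopeSupport (l : Multiset E) (x : E) :
    ∃ y ∈ zonotope l, inner ℝ x y = zonotopeSupport l x := by
  induction l using Multiset.induction with
  | empty => exact ⟨0, by simp, by simp [zonotopeSupport]⟩
  | cons v l ih =>
    obtain ⟨y, hy, h⟩ := ih
    rw [zonotope_cons]
    have : ∃ a ∈ Icc (-1 : ℝ) 1, a * inner ℝ x v = |inner ℝ x v| := by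
      rcases le_total 0 (inner ℝ x v) with h | h
      · exact ⟨1, by simp, by rw [abs_of_nonneg h, one_mul]⟩
      · exact ⟨-1, by simp, by rw [abs_of_nonpos h, neg_one_mul]⟩
    obtain ⟨a, ha, ha'⟩ := this
    refine ⟨a • v + y, ⟨_, mem_segment_neg_self.2 ⟨a, ha, rfl⟩, y, hy, rfl⟩, ?_⟩
    simp only [zonotopeSupport, Multiset.map_cons, Multiset.sum_cons] at h ⊢
    rw [inner_add_right, h, inner_smul_right, ha']

theorem zonotopeSupport_add (l m : Multiset E) (x : E) :
    zonotopeSupport (l + m) x = zonotopeSupport l x + zonotopeSupport m x := by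
  simp [zonotopeSupport]

theorem zonotopeSupport_map_smul {s : ℝ} (hs : 0 ≤ s) (l : Multiset E) (x : E) :
    zonotopeSupport (l.map (s • ·)) x = s * zonotopeSupport l x := by
  simp [zonotopeSupport, inner_smul_right, abs_mul, abs_of_nonneg hs, Multiset.sum_map_mul_left]

theorem zonotopeSupport_smul {s : ℝ} (hs : 0 ≤ s) (l : Multiset E) (x : E) :
    zonotopeSupport l (s • x) = s * zonotopeSupport l x := by
  simp [zonotopeSupport, inner_smul_left, abs_mul, abs_of_nonneg hs, Multiset.sum_map_mul_left]

theorem zonotope_subset_closedBall {l : Multiset E} {b : ℝ} (hb : 0 ≤ b)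
    (h : ∀ x : E, zonotopeSupport l x ≤ b * ‖x‖) : zonotope l ⊆ Metric.closedBall 0 b := by
  intro y hy
  rw [mem_closedBall_zero_iff]
  have h1 := (inner_le_zonotopeSupport hy y).trans (h y)
  rw [real_inner_self_eq_norm_mul_norm] at h1
  rcases (norm_nonneg y).eq_or_lt with h0 | h0
  · exact h0 ▸ hb
  · exact le_of_mul_le_mul_right h1 h0

theorem closedBall_subset_zonotope [CompleteSpace E] {l : Multiset E} {a : ℝ}
    (h : ∀ x : E, a * ‖x‖ ≤ zonotopeSupport l x) : Metric.closedBall 0 a ⊆ zonotope l := by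
  intro y hy
  rw [mem_closedBall_zero_iff] at hy
  by_contra hn
  obtain ⟨f, c, h1, h2⟩ := geometric_hahn_banach_closed_point (convex_zonotope l)
    (isCompact_zonotope l).isClosed hn
  obtain ⟨z, hz, hz'⟩ := exists_inner_eq_zonotopeSupport l ((InnerProductSpace.toDual ℝ E).symm f)
  rw [InnerProductSpace.toDual_symm_apply] at hz'
  have h3 : f y ≤ ‖f‖ * ‖y‖ := (le_abs_self _).trans (f.le_opNorm y)
  have h4 := h ((InnerProductSpace.toDual ℝ E).symm f)
  rw [LinearIsometryEquiv.norm_map, ← hz'] at h4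
  have := h1 z hz
  nlinarith [norm_nonneg f]

section Approximation

variable [FiniteDimensional ℝ E] [MeasurableSpace E] [BorelSpace E]

theorem setIntegral_abs_inner_eq {x y : E} (h : ‖x‖ = ‖y‖) :
    ∫ u in Metric.closedBall (0 : E) 1, |inner ℝ x u| =
      ∫ u in Metric.closedBall (0 : E) 1, |inner ℝ y u| := by
  set R := (ℝ ∙ (x - y))ᗮ.reflection
  have hR : R x = y := Submodule.reflection_sub h
  have h1 := R.measurePreserving.setIntegral_preimage_emb
    R.toHomeomorph.measurableEmbedding (fun u => |inner ℝ y u|) (Metric.closedBall 0 1)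
  rw [← h1, R.preimage_closedBall]
  simp only [← hR, LinearIsometryEquiv.inner_map_map, map_zero]

theorem setIntegral_abs_inner_pos {x : E} (hx : ‖x‖ = 1) :
    0 < ∫ u in Metric.closedBall (0 : E) 1, |inner ℝ x u| := by
  have hc : Continuous fun u : E => |inner ℝ x u| := by fun_prop
  rw [setIntegral_pos_iff_support_of_nonneg_ae (Filter.Eventually.of_forall fun _ => abs_nonneg _)
    (hc.continuousOn.integrableOn_compact (isCompact_closedBall _ _))]
  have ho : IsOpen ({u : E | |inner ℝ x u| ≠ 0} ∩ Metric.ball 0 1) :=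
    (isOpen_ne_fun hc continuous_const).inter Metric.isOpen_ball
  refine (ho.measure_pos volume ⟨(1 / 2 : ℝ) • x, ?_, ?_⟩).trans_le
    (measure_mono (inter_subset_inter_right _ Metric.ball_subset_closedBall))
  · change |inner ℝ x ((1 / 2 : ℝ) • x)| ≠ 0
    rw [inner_smul_right, real_inner_self_eq_norm_sq, hx]
    norm_num
  · rw [mem_ball_zero_iff, norm_smul, hx]
    norm_num

/-- Balls can be approximated by zonotopes. -/
theorem exists_zonotope_between [Nontrivial E] {a b : ℝ} (ha : 0 < a) (hab : a < b) :
    ∃ l : Multiset E, Metric.closedBall 0 a ⊆ zonotope l ∧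
      zonotope l ⊆ Metric.closedBall 0 b := by
  set B := Metric.closedBall (0 : E) 1 with hB
  have hB0 : volume B ≠ 0 := (Metric.measure_closedBall_pos volume (0 : E) one_pos).ne'
  have hBt : volume B ≠ ⊤ := (isCompact_closedBall (0 : E) 1).measure_lt_top.ne
  let F : C(E, C(Metric.sphere (0 : E) 1, ℝ)) :=
    ContinuousMap.curry ⟨fun z => |inner ℝ (z.2 : E) z.1|, by fun_prop⟩
  have hF : ∀ u x, F u x = |inner ℝ (x : E) u| := fun u x => rfl
  let T : Set C(Metric.sphere (0 : E) 1, ℝ) := {g | ∃ l, ∀ x, g x = zonotopeSupport l (x : E)}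
  have hT : Convex ℝ T := by
    rintro g ⟨l, hl⟩ g' ⟨l', hl'⟩ s t hs ht -
    refine ⟨l.map (s • ·) + l'.map (t • ·), fun x => ?_⟩
    rw [zonotopeSupport_add, zonotopeSupport_map_smul hs, zonotopeSupport_map_smul ht, ← hl, ← hl']
    simp
  have hFi : IntegrableOn F B volume :=
    F.continuous.continuousOn.integrableOn_compact (isCompact_closedBall _ _)
  have hmem : ⨍ u in B, F u ∈ closure T := by
    refine hT.closure.set_average_mem isClosed_closure hB0 hBt ?_ hFi
    exact Filter.Eventually.of_forall fun u => subset_closure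
      ⟨{u}, fun x => by simp [hF, zonotopeSupport]⟩
  obtain ⟨x₀, hx₀⟩ := exists_norm_eq E zero_le_one
  set c := (volume.real B)⁻¹ * ∫ u in B, |inner ℝ x₀ u| with hc
  have hc0 : 0 < c := mul_pos (inv_pos.2 (ENNReal.toReal_pos hB0 hBt))
    (setIntegral_abs_inner_pos hx₀)
  have hcx : ∀ x : Metric.sphere (0 : E) 1, (⨍ u in B, F u) x = c := by
    intro x
    rw [setAverage_eq, ContinuousMap.smul_apply, ContinuousMap.integral_apply hFi, smul_eq_mul, hc]
    congr 1
    exact setIntegral_abs_inner_eq ((mem_sphere_zero_iff_norm.1 x.2).trans hx₀.symm)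
  have hε : 0 < c * (b - a) / (a + b) := by
    apply div_pos (mul_pos hc0 (by linarith)) (by linarith)
  obtain ⟨g, ⟨l, hl⟩, hg⟩ := Metric.mem_closure_iff.1 hmem _ hε
  have hs : 0 < (a + b) / 2 / c := by
    apply div_pos (by linarith) hc0
  have hbd : ∀ x : E, a * ‖x‖ ≤ zonotopeSupport (l.map (((a + b) / 2 / c) • ·)) x ∧
      zonotopeSupport (l.map (((a + b) / 2 / c) • ·)) x ≤ b * ‖x‖ := by
    intro x
    rcases eq_or_ne x 0 with rfl | hx
    · simp [zonotopeSupport]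
    have hx0 : 0 < ‖x‖ := norm_pos_iff.2 hx
    have hxs : ‖x‖⁻¹ • x ∈ Metric.sphere (0 : E) 1 := by
      rw [mem_sphere_zero_iff_norm, norm_smul, norm_inv, norm_norm, inv_mul_cancel₀ hx0.ne']
    have hxe : x = ‖x‖ • ((⟨‖x‖⁻¹ • x, hxs⟩ : Metric.sphere (0 : E) 1) : E) := by
      simp [smul_smul, hx0.ne']
    have h1 := (ContinuousMap.dist_apply_le_dist (⟨‖x‖⁻¹ • x, hxs⟩ : Metric.sphere (0 : E) 1)).trans
      hg.le
    rw [hcx, hl, Real.dist_eq, abs_le] at h1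
    rw [zonotopeSupport_map_smul hs.le]
    rw [hxe, zonotopeSupport_smul hx0.le, ← hxe, mul_left_comm, mul_comm a, mul_comm b]
    set z := zonotopeSupport l (‖x‖⁻¹ • x)
    have e1 : (a + b) / 2 / c * (c * (b - a) / (a + b)) = (b - a) / 2 := by
      have : a + b ≠ 0 := by linarith
      field_simp
    have e2 : (a + b) / 2 / c * c = (a + b) / 2 := by
      field_simp
    constructor
    · apply mul_le_mul_of_nonneg_left _ hx0.le
      have := mul_le_mul_of_nonneg_left h1.2 hs.le
      rw [e1, mul_sub, e2] at this
      linarith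
    · apply mul_le_mul_of_nonneg_left _ hx0.le
      have := mul_le_mul_of_nonneg_left h1.1 hs.le
      rw [mul_neg, e1, mul_sub, e2] at this
      linarith
  exact ⟨_, closedBall_subset_zonotope fun x => (hbd x).1,
    zonotope_subset_closedBall (ha.trans hab).le fun x => (hbd x).2⟩

end Approximation

end Zonotopes

section PolynomialCoefficients

theorem coeff_eq_of_sum_eq {n : ℕ} {a b : ℕ → ℝ}
    (h : ∀ t : ℝ, 0 ≤ t → ∑ m ∈ Finset.range n, a m * t ^ m = ∑ m ∈ Finset.range n, b m * t ^ m)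
    {j : ℕ} (hj : j < n) : a j = b j := by
  set P : Polynomial ℝ := ∑ m ∈ Finset.range n, Polynomial.monomial m (a m)
  set Q : Polynomial ℝ := ∑ m ∈ Finset.range n, Polynomial.monomial m (b m)
  have hPQ : P = Q := by
    refine Polynomial.eq_of_infinite_eval_eq P Q ((Ici_infinite (0 : ℝ)).mono fun t ht => ?_)
    simpa [P, Q, Polynomial.eval_finsetSum] using h t ht
  have := congrArg (fun p => Polynomial.coeff p j) hPQ
  simpa [P, Q, Polynomial.finsetSum_coeff, Polynomial.coeff_monomial, hj] using this

/-- If all `j`-th forward differences at `0` of a polynomial function are nonnegative, then so is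
its `j`-th coefficient. -/
theorem coeff_nonneg_of_fwdDiff_nonneg {n j : ℕ} {a : ℕ → ℝ} (hj : j < n)
    (h : ∀ t : ℝ, 0 < t →
      0 ≤ (fwdDiff t)^[j] (fun x : ℝ => ∑ m ∈ Finset.range n, a m * x ^ m) 0) : 0 ≤ a j := by
  set S : ℕ → ℝ := fun m => (fwdDiff (1 : ℝ))^[j] (fun x : ℝ => x ^ m) 0 with hS
  have hlt : ∀ m < j, S m = 0 := fun m hm => by
    simp only [hS]
    rw [fwdDiff_iter_pow_eq_zero_of_lt hm]
    rfl
  have hjj : S j = j.factorial := by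
    simp only [hS]
    rw [fwdDiff_iter_eq_factorial]
    simp
  have h1 : ∀ t : ℝ, (fwdDiff t)^[j] (fun x : ℝ => ∑ m ∈ Finset.range n, a m * x ^ m) 0 =
      ∑ m ∈ Finset.range n, a m * S m * t ^ m := by
    intro t
    simp only [hS, fwdDiff_iter_eq_sum_shift, Finset.mul_sum, Finset.sum_mul, Finset.smul_sum]
    rw [Finset.sum_comm]
    refine Finset.sum_congr rfl fun m _ => Finset.sum_congr rfl fun k _ => ?_
    simp only [zero_add, nsmul_eq_mul, mul_one, zsmul_eq_mul, mul_pow]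
    ring
  have h2 : ∀ t : ℝ, 0 < t →
      0 ≤ ∑ m ∈ Finset.range n, if j ≤ m then a m * S m * t ^ (m - j) else 0 := by
    intro t ht
    have h3 := h t ht
    rw [h1] at h3
    refine le_of_mul_le_mul_left ?_ (pow_pos ht j)
    rw [mul_zero, Finset.mul_sum]
    refine h3.trans_eq (Finset.sum_congr rfl fun m _ => ?_)
    split_ifs with hm
    · rw [mul_left_comm, ← pow_add, Nat.add_sub_cancel' hm]
    · rw [hlt m (not_le.1 hm)]
      ring
  have h3 : Filter.Tendsto (fun t : ℝ =>
      ∑ m ∈ Finset.range n, if j ≤ m then a m * S m * t ^ (m - j) else 0)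
      (nhdsWithin 0 (Ioi 0)) (nhds (a j * S j)) := by
    have hc : Continuous fun t : ℝ =>
        ∑ m ∈ Finset.range n, if j ≤ m then a m * S m * t ^ (m - j) else 0 := by
      refine continuous_finsetSum _ fun m _ => ?_
      split_ifs
      · fun_prop
      · fun_prop
    have := (hc.tendsto 0).mono_left (nhdsWithin_le_nhds (s := Ioi 0))
    convert this using 2
    rw [Finset.sum_eq_single_of_mem j (Finset.mem_range.2 hj)]
    · simp
    · intro m _ hm
      split_ifs with h
      · rw [zero_pow (by omega), mul_zero]
      · rfl
  have h4 : 0 ≤ a j * S j :=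
    ge_of_tendsto h3 (Filter.eventually_of_mem self_mem_nhdsWithin h2)
  rw [hjj] at h4
  exact nonneg_of_mul_nonneg_left h4 (by positivity)

end PolynomialCoefficients

section Quermassintegrals

variable {E : Type*} [NormedAddCommGroup E] [InnerProductSpace ℝ E]

/-- Nonnegative functionals of multisets of vectors that are affine under scaling of any single
added vector. -/
def IsRayAffineNonneg (Ψ : Multiset E → ℝ) : Prop :=
  (∀ l, 0 ≤ Ψ l) ∧
    ∀ l v (t : ℝ), 0 ≤ t → Ψ (l + {t • v}) = Ψ l + t * (Ψ (l + {v}) - Ψ l)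

theorem IsRayAffineNonneg.le_add_singleton {Ψ : Multiset E → ℝ} (h : IsRayAffineNonneg Ψ)
    (l : Multiset E) (v : E) : Ψ l ≤ Ψ (l + {v}) := by
  by_contra! hlt
  have hpos : 0 < Ψ l - Ψ (l + {v}) := by linarith
  have ht : 0 ≤ (Ψ l + 1) / (Ψ l - Ψ (l + {v})) := div_nonneg (by linarith [h.1 l]) hpos.le
  have h1 := h.2 l v _ ht
  have h2 := h.1 (l + {((Ψ l + 1) / (Ψ l - Ψ (l + {v}))) • v})
  have h3 : (Ψ l + 1) / (Ψ l - Ψ (l + {v})) * (Ψ l - Ψ (l + {v})) = Ψ l + 1 :=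
    div_mul_cancel₀ _ hpos.ne'
  nlinarith

theorem IsRayAffineNonneg.le_add {Ψ : Multiset E → ℝ} (h : IsRayAffineNonneg Ψ)
    (l m : Multiset E) : Ψ l ≤ Ψ (l + m) := by
  induction m using Multiset.induction generalizing l with
  | empty => simp
  | cons v m ih =>
    refine (h.le_add_singleton l v).trans ?_
    have := ih (l + {v})
    rwa [add_assoc, Multiset.singleton_add] at this

theorem IsRayAffineNonneg.fwdDiff {Ψ : Multiset E → ℝ} (h : IsRayAffineNonneg Ψ)
    (m : Multiset E) : IsRayAffineNonneg (fwdDiff m Ψ) := by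
  refine ⟨fun l => sub_nonneg.2 (h.le_add l m), fun l v t ht => ?_⟩
  simp only [_root_.fwdDiff, add_right_comm _ _ m, h.2 _ v t ht]
  ring

theorem IsRayAffineNonneg.fwdDiff_iterate {Ψ : Multiset E → ℝ} (h : IsRayAffineNonneg Ψ)
    (m : Multiset E) (j : ℕ) : IsRayAffineNonneg ((_root_.fwdDiff m)^[j] Ψ) := by
  induction j with
  | zero => exact h
  | succ j ih => rw [Function.iterate_succ_apply']; exact ih.fwdDiff m

variable [FiniteDimensional ℝ E] [MeasurableSpace E] [BorelSpace E]

/-- `W` satisfies the Steiner formula of degree `d` on nonempty compact convex sets. -/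
def SatisfiesSteinerFormula (d : ℕ) (W : ℕ → Set E → ℝ) : Prop :=
  ∀ A : Set E, IsCompact A → Convex ℝ A → A.Nonempty → ∀ ε : ℝ, 0 ≤ ε →
    volume.real (A + Metric.closedBall 0 ε) =
      ∑ j ∈ Finset.range (d + 1), (d.choose j : ℝ) * W j A * ε ^ j

variable {d : ℕ} {W : ℕ → Set E → ℝ}

theorem tendsto_volume_add_zonotope (hW : SatisfiesSteinerFormula d W) {A : Set E}
    (hA : IsCompact A) (hAc : Convex ℝ A) (hAn : A.Nonempty) {t : ℝ} (ht : 0 < t)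
    {Z : ℕ → Multiset E} (hZ : ∀ n, Metric.closedBall 0 t ⊆ zonotope (Z n) ∧
      zonotope (Z n) ⊆ Metric.closedBall 0 (t + 1 / ((n : ℝ) + 1))) (k : ℕ) :
    Filter.Tendsto (fun n => volume.real (A + zonotope (k • Z n))) Filter.atTop
      (nhds (∑ j ∈ Finset.range (d + 1), (d.choose j : ℝ) * W j A * (k • t) ^ j)) := by
  have hsm : ∀ s : ℝ, 0 ≤ s →
      (k : ℝ) • Metric.closedBall (0 : E) s = Metric.closedBall 0 (k • s) := by
    intro s hs
    rw [smul_closedBall _ _ hs, smul_zero, Real.norm_natCast, nsmul_eq_mul]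
  have hc : Continuous fun s : ℝ =>
      ∑ j ∈ Finset.range (d + 1), (d.choose j : ℝ) * W j A * (k • s) ^ j := by
    fun_prop
  have h1 : Filter.Tendsto (fun n : ℕ => t + 1 / ((n : ℝ) + 1)) Filter.atTop (nhds t) := by
    simpa using (tendsto_one_div_add_atTop_nhds_zero_nat (𝕜 := ℝ)).const_add t
  refine tendsto_of_tendsto_of_tendsto_of_le_of_le tendsto_const_nhds
    ((hc.tendsto t).comp h1) (fun n => ?_) (fun n => ?_)
  · rw [← hW A hA hAc hAn (k • t) (by positivity), ← hsm t ht.le, zonotope_nsmul]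
    exact measureReal_mono (add_subset_add_left (smul_set_mono (hZ n).1))
      (hA.add ((isCompact_zonotope _).smul _)).measure_lt_top.ne
  · have h0 : 0 ≤ t + 1 / ((n : ℝ) + 1) := by positivity
    simp only [Function.comp_apply]
    rw [← hW A hA hAc hAn _ (by positivity), ← hsm _ h0, zonotope_nsmul]
    exact measureReal_mono (add_subset_add_left (smul_set_mono (hZ n).2))
      (hA.add ((isCompact_closedBall _ _).smul _)).measure_lt_top.ne

/-- An averaging inequality for volumes which persists after adding arbitrary zonotopes
holds for every quermassintegral. -/
theorem quermass_le_of_volume_add_zonotope_le [Nontrivial E] (hW : SatisfiesSteinerFormula d W)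
    {A K L : Set E} (hA : IsCompact A) (hAc : Convex ℝ A) (hAn : A.Nonempty)
    (hK : IsCompact K) (hKc : Convex ℝ K) (hKn : K.Nonempty)
    (hL : IsCompact L) (hLc : Convex ℝ L) (hLn : L.Nonempty)
    (h : ∀ l : Multiset E, volume.real (A + zonotope l) ≤
      1 / 2 * (volume.real (K + zonotope l) + volume.real (L + zonotope l)))
    {j : ℕ} (hj : j ≤ d) : W j A ≤ 1 / 2 * (W j K + W j L) := by
  set Ψ : Multiset E → ℝ := fun l =>
    1 / 2 * (volume.real (K + zonotope l) + volume.real (L + zonotope l)) -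
      volume.real (A + zonotope l) with hΨ_def
  have hΨ : IsRayAffineNonneg Ψ := by
    refine ⟨fun l => sub_nonneg.2 (h l), fun l v t ht => ?_⟩
    simp only [hΨ_def, zonotope_add, zonotope_singleton, ← add_assoc]
    rw [volume_add_segment (hK.add (isCompact_zonotope l)) (hKc.add (convex_zonotope l)) v ht,
      volume_add_segment (hL.add (isCompact_zonotope l)) (hLc.add (convex_zonotope l)) v ht,
      volume_add_segment (hA.add (isCompact_zonotope l)) (hAc.add (convex_zonotope l)) v ht]
    ring
  set a : ℕ → ℝ := fun m => d.choose m * (1 / 2 * (W m K + W m L) - W m A) with ha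
  have hnonneg : 0 ≤ a j := by
    refine coeff_nonneg_of_fwdDiff_nonneg (Nat.lt_succ_of_le hj) fun t ht => ?_
    have hZ : ∀ n : ℕ, ∃ Z : Multiset E, Metric.closedBall 0 t ⊆ zonotope Z ∧
        zonotope Z ⊆ Metric.closedBall 0 (t + 1 / ((n : ℝ) + 1)) := fun n =>
      exists_zonotope_between ht (lt_add_of_pos_right t (by positivity))
    choose Z hZ using hZ
    have hlim : Filter.Tendsto (fun n => (fwdDiff (Z n))^[j] Ψ 0) Filter.atTop
        (nhds ((fwdDiff t)^[j] (fun x : ℝ => ∑ m ∈ Finset.range (d + 1), a m * x ^ m) 0)) := by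
      simp only [fwdDiff_iter_eq_sum_shift, zero_add]
      refine tendsto_finsetSum _ fun k _ => Filter.Tendsto.const_smul ?_ _
      have := (((tendsto_volume_add_zonotope hW hK hKc hKn ht hZ k).add
        (tendsto_volume_add_zonotope hW hL hLc hLn ht hZ k)).const_mul (1 / 2)).sub
        (tendsto_volume_add_zonotope hW hA hAc hAn ht hZ k)
      convert this using 2
      rw [← Finset.sum_add_distrib, Finset.mul_sum, ← Finset.sum_sub_distrib]
      refine Finset.sum_congr rfl fun m _ => ?_
      simp only [ha]
      ring
    exact ge_of_tendsto' hlim fun n => (hΨ.fwdDiff_iterate (Z n) j).1 0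
  have hpos : (0 : ℝ) < d.choose j := by exact_mod_cast Nat.choose_pos hj
  have := nonneg_of_mul_nonneg_right hnonneg hpos
  linarith

theorem quermass_mono [Nontrivial E] (hW : SatisfiesSteinerFormula d W)
    {A K : Set E} (hA : IsCompact A) (hAc : Convex ℝ A) (hAn : A.Nonempty)
    (hK : IsCompact K) (hKc : Convex ℝ K) (hAK : A ⊆ K) {j : ℕ} (hj : j ≤ d) :
    W j A ≤ W j K := by
  have h := quermass_le_of_volume_add_zonotope_le hW hA hAc hAn hK hKc (hAn.mono hAK)
    hK hKc (hAn.mono hAK) (fun l => ?_) hj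
  · linarith
  · have := measureReal_mono (μ := volume) (add_subset_add_right (t := zonotope l) hAK)
      (hK.add (isCompact_zonotope l)).measure_lt_top.ne
    linarith

theorem quermass_eq_of_volume_add_closedBall_eq (hW : SatisfiesSteinerFormula d W)
    {A K : Set E} (hA : IsCompact A) (hAc : Convex ℝ A) (hAn : A.Nonempty)
    (hK : IsCompact K) (hKc : Convex ℝ K) (hKn : K.Nonempty)
    (h : ∀ ε : ℝ, 0 ≤ ε → volume.real (A + Metric.closedBall 0 ε) =
      volume.real (K + Metric.closedBall 0 ε)) {j : ℕ} (hj : j ≤ d) : W j A = W j K := by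
  have := coeff_eq_of_sum_eq (n := d + 1) (a := fun m => d.choose m * W m A)
    (b := fun m => d.choose m * W m K) (fun t ht => by
      rw [← hW A hA hAc hAn t ht, ← hW K hK hKc hKn t ht, h t ht]) (Nat.lt_succ_of_le hj)
  exact mul_left_cancel₀ (by exact_mod_cast (Nat.choose_pos hj).ne') this

theorem quermass_linearIsometryEquiv_image (hW : SatisfiesSteinerFormula d W)
    {A : Set E} (hA : IsCompact A) (hAc : Convex ℝ A) (hAn : A.Nonempty) (R : E ≃ₗᵢ[ℝ] E)
    {j : ℕ} (hj : j ≤ d) : W j (R '' A) = W j A := by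
  refine quermass_eq_of_volume_add_closedBall_eq hW (hA.image R.continuous)
    (hAc.linear_image R.toLinearEquiv.toLinearMap) (hAn.image R) hA hAc hAn (fun ε hε => ?_) hj
  have h1 : R '' A + Metric.closedBall 0 ε = R '' (A + Metric.closedBall 0 ε) := by
    rw [Set.image_add, R.image_closedBall, map_zero]
  rw [h1, measureReal_def, measureReal_def]
  congr 1
  have := R.measurePreserving.measure_preimage_emb R.toHomeomorph.measurableEmbedding
    (R '' (A + Metric.closedBall 0 ε))
  rw [← this]
  congr 1
  exact Set.preimage_image_eq _ R.injective

theorem quermass_steinerSymmetral_le [Nontrivial E] (hW : SatisfiesSteinerFormula d W)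
    {u : E} (hu : ‖u‖ = 1) {A : Set E} (hA : IsCompact A) (hAc : Convex ℝ A) (hAn : A.Nonempty)
    {j : ℕ} (hj : j ≤ d) : W j (steinerSymmetral u A) ≤ W j A := by
  have h := quermass_le_of_volume_add_zonotope_le hW (isCompact_steinerSymmetral u hA)
    (convex_steinerSymmetral u hAc) (nonempty_steinerSymmetral u hAn) hA hAc hAn
    (hA.image (ℝ ∙ u)ᗮ.reflection.continuous)
    (hAc.linear_image (ℝ ∙ u)ᗮ.reflection.toLinearEquiv.toLinearMap) (hAn.image _)
    (fun l => volume_steinerSymmetral_add_le hu hA hAc (isCompact_zonotope l)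
      (convex_zonotope l)) hj
  have h2 := quermass_linearIsometryEquiv_image hW hA hAc hAn (ℝ ∙ u)ᗮ.reflection hj
  have h3 : W j ((ℝ ∙ u)ᗮ.reflection.toLinearEquiv.toLinearMap '' A) = W j A := h2
  change W j (steinerSymmetral u A) ≤ 1 / 2 * (W j A + W j ((ℝ ∙ u)ᗮ.reflection '' A)) at h
  linarith

theorem volume_real_closedBall (hd : Module.finrank ℝ E = d) {ρ : ℝ} (hρ : 0 ≤ ρ) :
    volume.real (Metric.closedBall (0 : E) ρ) =
      ρ ^ d * volume.real (Metric.closedBall (0 : E) 1) := by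
  rw [measureReal_def, measureReal_def, Measure.addHaar_closedBall' volume _ hρ, hd,
    ENNReal.toReal_mul, ENNReal.toReal_ofReal (by positivity)]

theorem quermass_closedBall (hW : SatisfiesSteinerFormula d W) (hd : Module.finrank ℝ E = d)
    {ρ : ℝ} (hρ : 0 ≤ ρ) {j : ℕ} (hj : j ≤ d) :
    W j (Metric.closedBall (0 : E) ρ) =
      ρ ^ (d - j) * volume.real (Metric.closedBall (0 : E) 1) := by
  have := coeff_eq_of_sum_eq (n := d + 1)
    (a := fun m => d.choose m * W m (Metric.closedBall (0 : E) ρ))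
    (b := fun m => d.choose m * (ρ ^ (d - m) * volume.real (Metric.closedBall (0 : E) 1)))
    (fun t ht => ?_) (Nat.lt_succ_of_le hj)
  · exact mul_left_cancel₀ (by exact_mod_cast (Nat.choose_pos hj).ne') this
  · rw [← hW _ (isCompact_closedBall 0 ρ) (convex_closedBall 0 ρ)
      (Metric.nonempty_closedBall.2 hρ) t ht, closedBall_add_closedBall hρ ht, add_zero,
      volume_real_closedBall hd (by positivity), add_comm ρ t, add_pow, Finset.sum_mul]
    refine Finset.sum_congr rfl fun m _ => ?_
    ring

theorem quermass_add_closedBall (hW : SatisfiesSteinerFormula d W) {A : Set E}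
    (hA : IsCompact A) (hAc : Convex ℝ A) (hAn : A.Nonempty) {δ : ℝ} (hδ : 0 ≤ δ)
    {j : ℕ} (hj : j ≤ d) :
    d.choose j * W j (A + Metric.closedBall 0 δ) =
      ∑ m ∈ Finset.range (d + 1), d.choose m * W m A * (δ ^ (m - j) * m.choose j) := by
  refine coeff_eq_of_sum_eq (n := d + 1)
    (a := fun i => d.choose i * W i (A + Metric.closedBall 0 δ))
    (b := fun i => ∑ m ∈ Finset.range (d + 1), d.choose m * W m A * (δ ^ (m - i) * m.choose i))
    (fun t ht => ?_) (Nat.lt_succ_of_le hj)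
  rw [← hW _ (hA.add (isCompact_closedBall 0 δ)) (hAc.add (convex_closedBall 0 δ))
    (hAn.add (Metric.nonempty_closedBall.2 hδ)) t ht, add_assoc, closedBall_add_closedBall hδ ht,
    add_zero, hW A hA hAc hAn _ (by positivity)]
  simp only [Finset.sum_mul]
  rw [Finset.sum_comm]
  refine Finset.sum_congr rfl fun m hm => ?_
  have h : (δ + t) ^ m = ∑ i ∈ Finset.range (d + 1), t ^ i * δ ^ (m - i) * m.choose i := by
    rw [add_comm δ t, add_pow]
    refine Finset.sum_subset (Finset.range_mono (Finset.mem_range.1 hm)) fun i _ hi => ?_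
    rw [Nat.choose_eq_zero_of_lt (by simpa using hi), Nat.cast_zero, mul_zero]
  rw [h, Finset.mul_sum]
  refine Finset.sum_congr rfl fun i _ => ?_
  ring

end Quermassintegrals

section DifferenceBody

variable {E : Type*} [NormedAddCommGroup E] [InnerProductSpace ℝ E]

theorem reflection_orthogonal_singleton_apply {u : E} (hu : ‖u‖ = 1) (x : E) :
    (ℝ ∙ u)ᗮ.reflection x = x - (2 * inner ℝ u x) • u := by
  rw [Submodule.reflection_orthogonal_apply, Submodule.reflection_singleton_apply]
  simp only [hu, RCLike.ofReal_real_eq_id, id, one_pow, div_one]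
  module

theorem reflection_mem_steinerSymmetral (u : E) {A : Set E} {z : E}
    (hz : z ∈ steinerSymmetral u A) : (ℝ ∙ u)ᗮ.reflection z ∈ steinerSymmetral u A := by
  obtain ⟨a, ha, b, hb, hab, rfl⟩ := hz
  refine ⟨b, hb, a, ha, hab.symm, ?_⟩
  rw [map_smul, map_add, Submodule.reflection_reflection, add_comm]

theorem reflection_mem_steinerSymmetral_of_inner_eq_zero {u w : E} (hu : ‖u‖ = 1) (hw : ‖w‖ = 1)
    (huw : inner ℝ u w = 0) {A : Set E} (hA : ∀ x ∈ A, (ℝ ∙ w)ᗮ.reflection x ∈ A) {z : E}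
    (hz : z ∈ steinerSymmetral u A) : (ℝ ∙ w)ᗮ.reflection z ∈ steinerSymmetral u A := by
  have hcomm : ∀ x : E, (ℝ ∙ w)ᗮ.reflection ((ℝ ∙ u)ᗮ.reflection x) =
      (ℝ ∙ u)ᗮ.reflection ((ℝ ∙ w)ᗮ.reflection x) := fun x => by
    have hwu : inner ℝ w u = 0 := by rw [real_inner_comm, huw]
    simp only [reflection_orthogonal_singleton_apply hu, reflection_orthogonal_singleton_apply hw,
      inner_sub_right, inner_smul_right, huw, hwu]
    module
  obtain ⟨a, ha, b, hb, hab, rfl⟩ := hz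
  refine ⟨_, hA a ha, _, hA b hb, ?_, ?_⟩
  · rw [← hcomm, ← map_add, hab, map_add, hcomm]
  · rw [map_smul, map_add, hcomm]

theorem smul_steinerSymmetral_add_neg_subset (u : E) {A B : Set E}
    (h : (1 / 2 : ℝ) • (A + -A) ⊆ B) :
    (1 / 2 : ℝ) • (steinerSymmetral u A + -steinerSymmetral u A) ⊆ steinerSymmetral u B := by
  rintro _ ⟨_, ⟨_, ⟨a, ha, b, hb, hab, rfl⟩, y, ⟨a', ha', b', hb', hab', hy⟩, rfl⟩, rfl⟩
  have hB : ∀ x ∈ A, ∀ x' ∈ A, (1 / 2 : ℝ) • (x - x') ∈ B := fun x hx x' hx' =>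
    h (smul_mem_smul_set (by
      rw [sub_eq_add_neg]
      exact add_mem_add hx (Set.neg_mem_neg.2 hx')))
  refine ⟨_, hB a ha a' ha', _, hB b hb b' hb', ?_, ?_⟩
  · simp only [map_smul, map_sub, ← smul_add]
    rw [sub_add_sub_comm, sub_add_sub_comm, hab, hab']
  · simp only [map_smul, map_sub]
    rw [← neg_neg y, hy]
    module

variable [FiniteDimensional ℝ E] [MeasurableSpace E] [BorelSpace E]

theorem volume_le_volume_difference_body {A : Set E} (hA : IsCompact A) (hAc : Convex ℝ A) :
    volume A ≤ volume ((1 / 2 : ℝ) • (A + -A)) := by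
  set b := stdOrthonormalBasis ℝ E
  have key : ∀ s : Finset (Fin (Module.finrank ℝ E)), ∃ A' B' : Set E,
      IsCompact A' ∧ Convex ℝ A' ∧ IsCompact B' ∧ Convex ℝ B' ∧ volume A' = volume A ∧
      volume B' = volume ((1 / 2 : ℝ) • (A + -A)) ∧ (1 / 2 : ℝ) • (A' + -A') ⊆ B' ∧
      ∀ i ∈ s, ∀ x ∈ A', (ℝ ∙ b i)ᗮ.reflection x ∈ A' := by
    intro s
    induction s using Finset.induction_on with
    | empty =>
      exact ⟨A, _, hA, hAc, (hA.add hA.neg).smul _, (hAc.add hAc.neg).smul _, rfl, rfl, le_rfl,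
        by simp⟩
    | insert i s hi ih =>
      obtain ⟨A', B', h1, h2, h3, h4, h5, h6, h7, h8⟩ := ih
      have hbi : ∀ i, ‖b i‖ = 1 := b.orthonormal.1
      refine ⟨steinerSymmetral (b i) A', steinerSymmetral (b i) B',
        isCompact_steinerSymmetral _ h1, convex_steinerSymmetral _ h2,
        isCompact_steinerSymmetral _ h3, convex_steinerSymmetral _ h4,
        (volume_steinerSymmetral (hbi i) h1 h2).trans h5,
        (volume_steinerSymmetral (hbi i) h3 h4).trans h6,
        smul_steinerSymmetral_add_neg_subset _ h7, fun k hk x hx => ?_⟩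
      rcases Finset.mem_insert.1 hk with rfl | hk'
      · exact reflection_mem_steinerSymmetral _ hx
      · refine reflection_mem_steinerSymmetral_of_inner_eq_zero (hbi i) (hbi k) ?_ (h8 k hk') hx
        exact b.orthonormal.2 (fun h => hi (h ▸ hk'))
  obtain ⟨A', B', -, -, -, -, h5, h6, h7, h8⟩ := key Finset.univ
  rw [← h5, ← h6]
  refine measure_mono fun x hx => h7 ?_
  have hneg : ∀ s : Finset (Fin (Module.finrank ℝ E)),
      x - (2 : ℝ) • ∑ i ∈ s, inner ℝ (b i) x • b i ∈ A' := by
    intro s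
    induction s using Finset.induction_on with
    | empty => simpa using hx
    | insert i s hi ih =>
      have h := h8 i (Finset.mem_univ i) _ ih
      have hz : inner ℝ (b i) (∑ k ∈ s, inner ℝ (b k) x • b k) = 0 := by
        rw [inner_sum]
        refine Finset.sum_eq_zero fun k hk => ?_
        rw [inner_smul_right, b.orthonormal.2 (fun h : i = k => hi (h ▸ hk)), mul_zero]
      rw [reflection_orthogonal_singleton_apply (b.orthonormal.1 i), inner_sub_right,
        inner_smul_right, hz] at h
      rw [Finset.sum_insert hi]
      convert h using 1
      module
  have h9 := hneg Finset.univ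
  rw [b.sum_repr' x] at h9
  have h10 : -x ∈ A' := by
    convert h9 using 1
    module
  exact ⟨x + x, add_mem_add hx h10, by simp only; module⟩

variable {d : ℕ} {W : ℕ → Set E → ℝ}

theorem quermass_le_difference_body [Nontrivial E] (hW : SatisfiesSteinerFormula d W)
    {K : Set E} (hK : IsCompact K) (hKc : Convex ℝ K) (hKn : K.Nonempty) {j : ℕ} (hj : j ≤ d) :
    W j K ≤ W j ((1 / 2 : ℝ) • (K + -K)) := by
  have hD : IsCompact ((1 / 2 : ℝ) • (K + -K)) := (hK.add hK.neg).smul _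
  have hDc : Convex ℝ ((1 / 2 : ℝ) • (K + -K)) := (hKc.add hKc.neg).smul _
  have hDn : ((1 / 2 : ℝ) • (K + -K)).Nonempty := (hKn.add hKn.neg).smul_set
  have h := quermass_le_of_volume_add_zonotope_le hW hK hKc hKn hD hDc hDn hD hDc hDn
    (fun l => ?_) hj
  · linarith
  · have h1 := volume_le_volume_difference_body (hK.add (isCompact_zonotope l))
      (hKc.add (convex_zonotope l))
    have h2 : (1 / 2 : ℝ) • (K + zonotope l + -(K + zonotope l)) =
        (1 / 2 : ℝ) • (K + -K) + zonotope l := by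
      rw [neg_add, neg_zonotope, add_add_add_comm, smul_add, smul_add _ (zonotope l) (zonotope l),
        ← (convex_zonotope l).add_smul (by norm_num) (by norm_num), add_halves, one_smul]
    rw [h2] at h1
    have h3 := ENNReal.toReal_mono (hD.add (isCompact_zonotope l)).measure_lt_top.ne h1
    simp only [measureReal_def]
    linarith

/-- Among convex bodies of diameter `D`, balls have the largest quermassintegrals. -/
theorem quermass_le_of_dist_le [Nontrivial E] (hW : SatisfiesSteinerFormula d W)
    (hd : Module.finrank ℝ E = d) {K : Set E} (hK : IsCompact K) (hKc : Convex ℝ K)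
    (hKn : K.Nonempty) {D : ℝ} (hD : ∀ x ∈ K, ∀ y ∈ K, dist x y ≤ D) {j : ℕ} (hj : j ≤ d) :
    W j K ≤ (D / 2) ^ (d - j) * volume.real (Metric.closedBall (0 : E) 1) := by
  have hD0 : 0 ≤ D := by
    obtain ⟨x, hx⟩ := hKn
    exact dist_nonneg.trans (hD x hx x hx)
  rw [← quermass_closedBall hW hd (by positivity) hj]
  refine (quermass_le_difference_body hW hK hKc hKn hj).trans
    (quermass_mono hW ((hK.add hK.neg).smul _) ((hKc.add hKc.neg).smul _)
      (hKn.add hKn.neg).smul_set (isCompact_closedBall _ _) (convex_closedBall _ _) ?_ hj)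
  rintro _ ⟨_, ⟨x, hx, y, hy, rfl⟩, rfl⟩
  have := hD x hx (-y) hy
  rw [dist_eq_norm, sub_neg_eq_add] at this
  simp only [mem_closedBall_zero_iff, norm_smul, Real.norm_eq_abs]
  rw [abs_of_pos (by norm_num)]
  linarith

end DifferenceBody

section ContactSets

variable {E : Type*} [NormedAddCommGroup E] [InnerProductSpace ℝ E]

theorem exists_of_mem_steinerSymmetral_of_subset_closedBall {u : E} {L : Set E} {ρ : ℝ}
    (hL : L ⊆ Metric.closedBall 0 ρ) {z : E} (hz : z ∈ steinerSymmetral u L) :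
    ‖z‖ ≤ ρ ∧ (‖z‖ = ρ → z ∈ L ∧ (ℝ ∙ u)ᗮ.reflection z ∈ L) := by
  obtain ⟨a, ha, b, hb, hab, rfl⟩ := hz
  have ha' : a ∈ Metric.closedBall (0 : E) ρ := hL ha
  have hb' : (ℝ ∙ u)ᗮ.reflection b ∈ Metric.closedBall (0 : E) ρ := by
    rw [mem_closedBall_zero_iff, LinearIsometryEquiv.norm_map]
    exact mem_closedBall_zero_iff.1 (hL hb)
  rw [smul_add]
  constructor
  · exact mem_closedBall_zero_iff.1
      (convex_closedBall 0 ρ ha' hb' (by norm_num) (by norm_num) (by norm_num))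
  · intro h
    have hne : a = (ℝ ∙ u)ᗮ.reflection b := by
      by_contra hne
      have := combo_mem_ball_of_ne ha' hb' hne (one_half_pos (α := ℝ)) one_half_pos
        (add_halves 1)
      rw [mem_ball_zero_iff] at this
      exact this.ne h
    rw [← hne, ← add_smul, add_halves, one_smul]
    refine ⟨ha, ?_⟩
    rwa [hne, Submodule.reflection_reflection]

theorem steinerSymmetral_subset_closedBall {u : E} {L : Set E} {ρ : ℝ}
    (hL : L ⊆ Metric.closedBall 0 ρ) : steinerSymmetral u L ⊆ Metric.closedBall 0 ρ :=
  fun _ hz => mem_closedBall_zero_iff.2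
    (exists_of_mem_steinerSymmetral_of_subset_closedBall hL hz).1

/-- If a class of compact sets is stable under Steiner symmetrization, then any member contained in
a ball but missing a point of the bounding sphere can be moved within the class into a smaller
ball. -/
theorem exists_subset_closedBall_of_steinerSymmetral_mem [FiniteDimensional ℝ E]
    {F : Set (Set E)} (hFc : ∀ L ∈ F, IsCompact L)
    (hFs : ∀ L ∈ F, ∀ u : E, ‖u‖ = 1 → steinerSymmetral u L ∈ F) {L : Set E} (hL : L ∈ F) {ρ : ℝ}
    (hLρ : L ⊆ Metric.closedBall 0 ρ) {z : E} (hz : ‖z‖ = ρ) (hzL : z ∉ L) :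
    ∃ L' ∈ F, L' ⊆ Metric.ball 0 ρ := by
  have hcover : Metric.sphere (0 : E) ρ ∩ L ⊆
      ⋃ u : {u : E // ‖u‖ = 1}, (ℝ ∙ (u : E))ᗮ.reflection ⁻¹' Lᶜ := by
    rintro w ⟨hw, hwL⟩
    rw [mem_sphere_zero_iff_norm] at hw
    have hne : w - z ≠ 0 := fun h => hzL (sub_eq_zero.1 h ▸ hwL)
    have h1 : ‖‖w - z‖⁻¹ • (w - z)‖ = 1 := by
      rw [norm_smul, norm_inv, norm_norm, inv_mul_cancel₀ (norm_ne_zero_iff.2 hne)]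
    refine mem_iUnion.2 ⟨⟨_, h1⟩, ?_⟩
    have h2 : (ℝ ∙ (‖w - z‖⁻¹ • (w - z))) = (ℝ ∙ (w - z)) :=
      Submodule.span_singleton_smul_eq (inv_ne_zero (norm_ne_zero_iff.2 hne)).isUnit _
    have h3 : (ℝ ∙ (‖w - z‖⁻¹ • (w - z)))ᗮ.reflection w = z := by
      simp only [h2]
      exact Submodule.reflection_sub (hw.trans hz.symm)
    rw [mem_preimage, h3]
    exact hzL
  obtain ⟨t, ht⟩ := (((isCompact_sphere 0 ρ).inter (hFc L hL))).elim_finite_subcover _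
    (fun u : {u : E // ‖u‖ = 1} => (hFc L hL).isClosed.isOpen_compl.preimage
      (ℝ ∙ (u : E))ᗮ.reflection.continuous) hcover
  have key : ∀ s : Finset {u : E // ‖u‖ = 1}, ∃ L' ∈ F, L' ⊆ Metric.closedBall 0 ρ ∧
      ∀ x ∈ L', ‖x‖ = ρ → x ∈ L ∧ ∀ u ∈ s, (ℝ ∙ (u : E))ᗮ.reflection x ∈ L := by
    classical
    intro s
    induction s using Finset.induction_on with
    | empty => exact ⟨L, hL, hLρ, fun x hx _ => ⟨hx, by simp⟩⟩
    | insert u s _ ih =>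
      obtain ⟨L', h1, h2, h3⟩ := ih
      refine ⟨steinerSymmetral u L', hFs L' h1 u u.2, steinerSymmetral_subset_closedBall h2,
        fun x hx hxρ => ?_⟩
      obtain ⟨h4, h5⟩ := (exists_of_mem_steinerSymmetral_of_subset_closedBall h2 hx).2 hxρ
      refine ⟨(h3 x h4 hxρ).1, fun v hv => ?_⟩
      rcases Finset.mem_insert.1 hv with rfl | hv'
      · exact (h3 _ h5 (by rw [LinearIsometryEquiv.norm_map, hxρ])).1
      · exact (h3 x h4 hxρ).2 v hv'
  obtain ⟨L', h1, h2, h3⟩ := key t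
  refine ⟨L', h1, fun x hx => mem_ball_zero_iff.2
    (lt_of_le_of_ne (mem_closedBall_zero_iff.1 (h2 hx)) fun hxρ => ?_)⟩
  obtain ⟨h4, h5⟩ := h3 x hx hxρ
  obtain ⟨u, hu, hxu⟩ := mem_iUnion₂.1 (ht ⟨mem_sphere_zero_iff_norm.2 hxρ, h4⟩)
  exact hxu (h5 u hu)

end ContactSets

section Minimization

open TopologicalSpace

theorem exists_dist_lt_of_dist_lt {E : Type*} [MetricSpace E] {L L' : NonemptyCompacts E} {δ : ℝ} (h : dist L L' < δ) {x : E}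
    (hx : x ∈ L) : ∃ y ∈ L', dist x y < δ :=
  Metric.exists_dist_lt_of_hausdorffDist_lt hx h
    (Metric.hausdorffEDist_ne_top_of_nonempty_of_bounded L.nonempty L'.nonempty
      L.isCompact.isBounded L'.isCompact.isBounded)

variable {E : Type*} [NormedAddCommGroup E]

theorem subset_add_closedBall_of_dist_lt {L L' : NonemptyCompacts E} {δ : ℝ}
    (h : dist L L' < δ) : (L : Set E) ⊆ (L' : Set E) + Metric.closedBall 0 δ := by
  intro x hx
  obtain ⟨y, hy, hxy⟩ := exists_dist_lt_of_dist_lt h hx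
  refine ⟨y, hy, x - y, ?_, by simp⟩
  rw [mem_closedBall_zero_iff, ← dist_eq_norm]
  exact hxy.le

variable [InnerProductSpace ℝ E]

theorem isClosed_setOf_convex : IsClosed {L : NonemptyCompacts E | Convex ℝ (L : Set E)} := by
  refine isClosed_of_closure_subset fun L hL => ?_
  rw [Metric.mem_closure_iff] at hL
  intro x hx y hy a b ha hb hab
  refine L.isCompact.isClosed.closure_subset (Metric.mem_closure_iff.2 fun ε hε => ?_)
  obtain ⟨L', hL', hd⟩ := hL (ε / 2) (half_pos hε)
  obtain ⟨x', hx', hxx'⟩ := exists_dist_lt_of_dist_lt hd hx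
  obtain ⟨y', hy', hyy'⟩ := exists_dist_lt_of_dist_lt hd hy
  obtain ⟨z, hz, hzz⟩ := exists_dist_lt_of_dist_lt ((dist_comm L' L).trans_lt hd)
    (hL' hx' hy' ha hb hab)
  refine ⟨z, hz, ?_⟩
  have h1 : dist (a • x + b • y) (a • x' + b • y') ≤ a * (ε / 2) + b * (ε / 2) := by
    refine (dist_add_add_le _ _ _ _).trans ?_
    rw [dist_smul₀, dist_smul₀, Real.norm_of_nonneg ha, Real.norm_of_nonneg hb]
    gcongr
  rw [← add_mul, hab, one_mul] at h1
  linarith [dist_triangle (a • x + b • y) (a • x' + b • y') z]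

variable [FiniteDimensional ℝ E] [MeasurableSpace E] [BorelSpace E] {d : ℕ} {W : ℕ → Set E → ℝ}

theorem isClosed_setOf_quermass_le [Nontrivial E] (hW : SatisfiesSteinerFormula d W)
    {R v w : ℝ} {j : ℕ} (hj : j ≤ d) :
    IsClosed {L : NonemptyCompacts E | Convex ℝ (L : Set E) ∧ (L : Set E) ⊆ Metric.closedBall 0 R ∧
      v ≤ volume.real (L : Set E) ∧ W j L ≤ w} := by
  refine isClosed_of_closure_subset fun L hL => ?_
  have hc : Convex ℝ (L : Set E) := by
    refine isClosed_setOf_convex.closure_subset (closure_mono ?_ hL)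
    exact fun L hL => hL.1
  have hR : (L : Set E) ⊆ Metric.closedBall 0 R := by
    refine (NonemptyCompacts.isClosed_subsets_of_isClosed
      Metric.isClosed_closedBall).closure_subset (closure_mono ?_ hL)
    exact fun L hL => hL.2.1
  rw [Metric.mem_closure_iff] at hL
  have hpos : ∀ᶠ δ : ℝ in nhdsWithin 0 (Ioi 0), 0 < δ := self_mem_nhdsWithin
  refine ⟨hc, hR, ?_, ?_⟩
  · have hlim : Filter.Tendsto
        (fun δ : ℝ => ∑ i ∈ Finset.range (d + 1), (d.choose i : ℝ) * W i L * δ ^ i)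
        (nhdsWithin 0 (Ioi 0)) (nhds (volume.real (L : Set E))) := by
      have h0 := hW L L.isCompact hc L.nonempty 0 le_rfl
      rw [Metric.closedBall_zero, add_singleton, image_congr (fun x _ => add_zero x),
        image_id'] at h0
      rw [h0]
      exact (Continuous.tendsto (by fun_prop) 0).mono_left nhdsWithin_le_nhds
    refine ge_of_tendsto hlim (hpos.mono fun δ hδ => ?_)
    obtain ⟨L', ⟨-, -, hv, -⟩, hd⟩ := hL δ hδ
    rw [← hW L L.isCompact hc L.nonempty δ hδ.le]
    exact hv.trans (measureReal_mono
      (subset_add_closedBall_of_dist_lt ((dist_comm L' L).trans_lt hd))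
      (L.isCompact.add (isCompact_closedBall _ _)).measure_lt_top.ne)
  · have hlim : Filter.Tendsto (fun δ : ℝ => ∑ m ∈ Finset.range (d + 1),
        d.choose m * (if m = j then w else W m (Metric.closedBall 0 R)) *
          (δ ^ (m - j) * m.choose j)) (nhdsWithin 0 (Ioi 0)) (nhds (d.choose j * w)) := by
      have hval : ∑ m ∈ Finset.range (d + 1),
          d.choose m * (if m = j then w else W m (Metric.closedBall 0 R)) *
            ((0 : ℝ) ^ (m - j) * m.choose j) = d.choose j * w := by
        rw [Finset.sum_eq_single_of_mem j (Finset.mem_range_succ_iff.2 hj)]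
        · simp
        · intro m _ hm
          rcases hm.lt_or_gt with h | h
          · simp [Nat.choose_eq_zero_of_lt h]
          · simp [Nat.sub_ne_zero_of_lt h]
      rw [← hval]
      refine (Continuous.tendsto ?_ 0).mono_left nhdsWithin_le_nhds
      fun_prop
    have hpc : (0 : ℝ) < d.choose j := by exact_mod_cast Nat.choose_pos hj
    refine le_of_mul_le_mul_left (ge_of_tendsto hlim (hpos.mono fun δ hδ => ?_)) hpc
    obtain ⟨L', ⟨hc', hR', -, hw⟩, hd⟩ := hL δ hδ
    have h1 : W j L ≤ W j ((L' : Set E) + Metric.closedBall 0 δ) :=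
      quermass_mono hW L.isCompact hc L.nonempty (L'.isCompact.add (isCompact_closedBall _ _))
        (hc'.add (convex_closedBall _ _)) (subset_add_closedBall_of_dist_lt hd) hj
    refine (mul_le_mul_of_nonneg_left h1 hpc.le).trans ?_
    rw [quermass_add_closedBall hW L'.isCompact hc' L'.nonempty hδ.le hj]
    refine Finset.sum_le_sum fun m hm => ?_
    gcongr
    split_ifs with h
    · rwa [h]
    · exact quermass_mono hW L'.isCompact hc' L'.nonempty (isCompact_closedBall _ _)
        (convex_closedBall _ _) hR' (Finset.mem_range_succ_iff.1 hm)

theorem exists_closedBall_of_quermass [Nontrivial E] (hW : SatisfiesSteinerFormula d W)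
    {K : Set E} (hK : IsCompact K) (hKc : Convex ℝ K) (hKn : K.Nonempty) {j : ℕ} (hj : j ≤ d) :
    ∃ ρ : ℝ, 0 ≤ ρ ∧ volume.real K ≤ volume.real (Metric.closedBall (0 : E) ρ) ∧
      W j (Metric.closedBall (0 : E) ρ) ≤ W j K := by
  obtain ⟨R, hR⟩ := hK.isBounded.subset_closedBall (0 : E)
  set F : Set (NonemptyCompacts E) := {L | Convex ℝ (L : Set E) ∧
    (L : Set E) ⊆ Metric.closedBall 0 R ∧ volume.real K ≤ volume.real (L : Set E) ∧
      W j L ≤ W j K}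
  have hFc : IsCompact F :=
    (NonemptyCompacts.isCompact_subsets_of_isCompact
      (isCompact_closedBall (0 : E) R)).of_isClosed_subset (isClosed_setOf_quermass_le hW hj) fun L hL => hL.2.1
  have hFn : F.Nonempty := ⟨⟨⟨K, hK⟩, hKn⟩, hKc, hR, le_rfl, le_rfl⟩
  obtain ⟨L, hL, hmin⟩ := hFc.exists_isMinOn hFn
    (f := fun L => dist L ({0} : NonemptyCompacts E)) (by fun_prop)
  set ρ := dist L ({0} : NonemptyCompacts E)
  have hnorm : ∀ L : NonemptyCompacts E, ∀ x ∈ L, ‖x‖ ≤ dist L ({0} : NonemptyCompacts E) := by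
    intro L x hx
    refine le_of_forall_gt fun c hc => ?_
    obtain ⟨y, hy, hxy⟩ := exists_dist_lt_of_dist_lt hc hx
    have : y = 0 := by simpa using hy
    rwa [this, dist_zero_right] at hxy
  have hLρ : (L : Set E) ⊆ Metric.closedBall 0 ρ := fun x hx =>
    mem_closedBall_zero_iff.2 (hnorm L x hx)
  refine ⟨ρ, dist_nonneg, ?_⟩
  suffices h : (L : Set E) = Metric.closedBall 0 ρ by
    rw [← h]
    exact hL.2.2
  refine hLρ.antisymm ?_
  rw [← convexHull_sphere_eq_closedBall (0 : E) (r := ρ) dist_nonneg]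
  refine convexHull_min (fun z hz => ?_) hL.1
  by_contra hzL
  have hFcpt : ∀ M ∈ (fun L : NonemptyCompacts E => (L : Set E)) '' F, IsCompact M := by
    rintro _ ⟨L', -, rfl⟩
    exact L'.isCompact
  have hFst : ∀ M ∈ (fun L : NonemptyCompacts E => (L : Set E)) '' F, ∀ u : E, ‖u‖ = 1 →
      steinerSymmetral u M ∈ (fun L : NonemptyCompacts E => (L : Set E)) '' F := by
    rintro _ ⟨L', ⟨h1, h2, h3, h4⟩, rfl⟩ u hu
    refine ⟨⟨⟨_, isCompact_steinerSymmetral u L'.isCompact⟩,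
      nonempty_steinerSymmetral u L'.nonempty⟩, ⟨convex_steinerSymmetral u h1,
      steinerSymmetral_subset_closedBall h2, ?_, ?_⟩, rfl⟩
    · change _ ≤ volume.real (steinerSymmetral u (L' : Set E))
      rwa [measureReal_def (s := steinerSymmetral u (L' : Set E)),
        volume_steinerSymmetral hu L'.isCompact h1]
    · exact (quermass_steinerSymmetral_le hW hu L'.isCompact h1 L'.nonempty hj).trans h4
  obtain ⟨_, ⟨L', hL', rfl⟩, hlt⟩ := exists_subset_closedBall_of_steinerSymmetral_mem
    hFcpt hFst (mem_image_of_mem _ hL) hLρ (mem_sphere_zero_iff_norm.1 hz) hzL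
  obtain ⟨x, hx, hmax⟩ := L'.isCompact.exists_isMaxOn L'.nonempty continuous_norm.continuousOn
  have hxρ : ‖x‖ < ρ := mem_ball_zero_iff.1 (hlt hx)
  have h1 : dist L' ({0} : NonemptyCompacts E) ≤ ‖x‖ := by
    refine Metric.hausdorffDist_le_of_mem_dist (norm_nonneg x) (fun y hy => ⟨0, by simp, ?_⟩)
      (fun y hy => ⟨x, hx, ?_⟩)
    · rw [dist_zero_right]
      exact hmax hy
    · have : y = 0 := by simpa using hy
      rw [this, dist_zero_left]
  exact absurd (hmin hL') (not_le.2 (h1.trans_lt hxρ))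

/-- Among convex bodies of given volume, balls have the smallest quermassintegrals. -/
theorem le_quermass_of_le_volume [Nontrivial E] (hW : SatisfiesSteinerFormula d W)
    (hd : Module.finrank ℝ E = d) {K : Set E} (hK : IsCompact K) (hKc : Convex ℝ K)
    (hKn : K.Nonempty) {R : ℝ}
    (h : R ^ d * volume.real (Metric.closedBall (0 : E) 1) ≤ volume.real K) {j : ℕ} (hj : j ≤ d)
    (hR : 0 ≤ R) :
    R ^ (d - j) * volume.real (Metric.closedBall (0 : E) 1) ≤ W j K := by
  obtain ⟨ρ, hρ, h1, h2⟩ := exists_closedBall_of_quermass hW hK hKc hKn hj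
  have hω : 0 < volume.real (Metric.closedBall (0 : E) 1) :=
    ENNReal.toReal_pos (Metric.measure_closedBall_pos volume _ one_pos).ne'
      (isCompact_closedBall _ _).measure_lt_top.ne
  have hd0 : d ≠ 0 := hd ▸ Module.finrank_pos.ne'
  have hRρ : R ≤ ρ := by
    have := h.trans h1
    rw [volume_real_closedBall hd hρ] at this
    exact (pow_le_pow_iff_left₀ hR hρ hd0).1 (le_of_mul_le_mul_right this hω)
  rw [quermass_closedBall hW hd hρ hj] at h2
  refine le_trans ?_ h2
  gcongr

end Minimization

section UnionsOfBalls

variable {E : Type*} [NormedAddCommGroup E] [InnerProductSpace ℝ E]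

theorem convexHull_iUnion_closedBall {ι : Type*} (x : ι → E) (r : ℝ) :
    convexHull ℝ (⋃ i, Metric.closedBall (x i) r) =
      convexHull ℝ (range x) + Metric.closedBall 0 r := by
  have h : ⋃ i, Metric.closedBall (x i) r = range x + Metric.closedBall 0 r := by
    simp_rw [← iUnion_add_left_image, biUnion_range]
    simp
  rw [h, convexHull_add, (convex_closedBall (0 : E) r).convexHull_eq]

theorem dist_le_of_mem_convexHull_add_closedBall {ι : Type*} {x : ι → E} {D r : ℝ}
    (hx : ∀ i j, dist (x i) (x j) ≤ D) {y z : E}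
    (hy : y ∈ convexHull ℝ (range x) + Metric.closedBall 0 r)
    (hz : z ∈ convexHull ℝ (range x) + Metric.closedBall 0 r) : dist y z ≤ D + 2 * r := by
  obtain ⟨a, ha, b, hb, rfl⟩ := hy
  obtain ⟨a', ha', b', hb', rfl⟩ := hz
  obtain ⟨_, ⟨i, rfl⟩, _, ⟨k, rfl⟩, h⟩ := convexHull_exists_dist_ge2 ha ha'
  rw [mem_closedBall_zero_iff] at hb hb'
  have h1 := dist_add_add_le a b a' b'
  have h2 := hx i k
  have h3 := dist_le_norm_add_norm b b'
  simp only
  linarith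

variable [FiniteDimensional ℝ E] [MeasurableSpace E] [BorelSpace E]

theorem card_mul_pow_mul_volume_le [Nontrivial E] {ι : Type*} [Fintype ι] {x : ι → E} {D : ℝ}
    (hD : 0 ≤ D) (hx : Pairwise fun i j => D ≤ dist (x i) (x j)) :
    Fintype.card ι * ((D / 2) ^ Module.finrank ℝ E *
      volume.real (Metric.closedBall (0 : E) 1)) ≤
      volume.real (convexHull ℝ (range x) + Metric.closedBall 0 (D / 2)) := by
  have hcpt : IsCompact (convexHull ℝ (range x) + Metric.closedBall 0 (D / 2)) :=
    ((finite_range x).isCompact_convexHull ℝ).add (isCompact_closedBall _ _)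
  have hsub : ⋃ i, Metric.ball (x i) (D / 2) ⊆
      convexHull ℝ (range x) + Metric.closedBall 0 (D / 2) := by
    rw [← convexHull_iUnion_closedBall]
    exact (iUnion_mono fun i => Metric.ball_subset_closedBall).trans (subset_convexHull ℝ _)
  refine le_trans (le_of_eq ?_) (measureReal_mono hsub hcpt.measure_lt_top.ne)
  rw [measureReal_iUnion_fintype (fun i j hij => Metric.ball_disjoint_ball
    (by linarith [hx hij])) (fun i => measurableSet_ball)]
  have h : ∀ i, volume.real (Metric.ball (x i) (D / 2)) =
      (D / 2) ^ Module.finrank ℝ E * volume.real (Metric.closedBall (0 : E) 1) := fun i => by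
    rw [measureReal_def, ← Measure.addHaar_closedBall_eq_addHaar_ball,
      Measure.addHaar_closedBall_center, ← measureReal_def,
      volume_real_closedBall rfl (by positivity)]
  simp [h]

variable {d : ℕ} {W : ℕ → Set E → ℝ}

theorem le_quermass_of_pow_le_card [Nontrivial E] (hW : SatisfiesSteinerFormula d W)
    (hd : Module.finrank ℝ E = d) {ι : Type*} [Fintype ι] (hι : 2 ^ d ≤ Fintype.card ι)
    {x : ι → E} {D r : ℝ} (hD : 0 ≤ D) (hr : D / 2 ≤ r)
    (hx : Pairwise fun i j => D ≤ dist (x i) (x j)) {j : ℕ} (hj : j ≤ d) :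
    (r + D / 2) ^ (d - j) * volume.real (Metric.closedBall (0 : E) 1) ≤
      W j (convexHull ℝ (range x) + Metric.closedBall 0 r) := by
  have : Nonempty ι := Fintype.card_pos_iff.1 (hι.trans_lt' (by positivity))
  set L := convexHull ℝ (range x) + Metric.closedBall (0 : E) (D / 2) with hL_def
  have hs : 0 ≤ r - D / 2 := sub_nonneg.2 hr
  have hL : IsCompact L :=
    ((finite_range x).isCompact_convexHull ℝ).add (isCompact_closedBall _ _)
  have hLc : Convex ℝ L := (convex_convexHull ℝ _).add (convex_closedBall _ _)
  have hLn : L.Nonempty :=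
    (range_nonempty x).convexHull.add (Metric.nonempty_closedBall.2 (by positivity))
  have hLr : convexHull ℝ (range x) + Metric.closedBall (0 : E) r =
      L + Metric.closedBall 0 (r - D / 2) := by
    rw [hL_def, add_assoc, closedBall_add_closedBall (by positivity) hs, add_zero,
      add_sub_cancel]
  have hvol : D ^ d * volume.real (Metric.closedBall (0 : E) 1) ≤ volume.real L := by
    refine le_trans ?_ (card_mul_pow_mul_volume_le hD hx)
    have hι' : (2 : ℝ) ^ d ≤ Fintype.card ι := by exact_mod_cast hι
    rw [hd, ← mul_assoc]
    gcongr
    calc D ^ d = 2 ^ d * (D / 2) ^ d := by rw [← mul_pow, mul_div_cancel₀ D two_ne_zero]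
      _ ≤ _ := by gcongr
  have hquer : ∀ m ∈ Finset.range (d + 1),
      D ^ (d - m) * volume.real (Metric.closedBall (0 : E) 1) ≤ W m L := fun m hm =>
    le_quermass_of_le_volume hW hd hL hLc hLn hvol (Finset.mem_range_succ_iff.1 hm) hD
  rw [hLr]
  refine le_quermass_of_le_volume hW hd (hL.add (isCompact_closedBall _ _))
    (hLc.add (convex_closedBall _ _)) (hLn.add (Metric.nonempty_closedBall.2 hs)) ?_ hj
    (by linarith)
  rw [hW L hL hLc hLn _ hs, show r + D / 2 = (r - D / 2) + D by ring, add_pow, Finset.sum_mul]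
  refine Finset.sum_le_sum fun m hm => ?_
  calc (r - D / 2) ^ m * D ^ (d - m) * d.choose m * volume.real (Metric.closedBall (0 : E) 1)
      = d.choose m * (D ^ (d - m) * volume.real (Metric.closedBall (0 : E) 1)) *
          (r - D / 2) ^ m := by ring
    _ ≤ d.choose m * W m L * (r - D / 2) ^ m := by
        gcongr
        exact hquer m hm

end UnionsOfBalls

/-- In Euclidean `d`-space, for `r ≥ λ/2 > 0`, `0 ≤ k < d`, `N ≥ 2^d`,
a uniform contraction does not increase the `k`-th quermassintegral of the convex hull of
the union of the `N` balls of radius `r`. The quermassintegrals `W k` are characterized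
on nonempty compact convex sets by the Steiner formula
`V(A + ε·B^d) = ∑_{k=0}^{d} (d choose k) · W k A · ε^k` for all `ε ≥ 0`. -/
theorem quermassintegral_convexHull_uniform_contraction
    (d N k : ℕ) (hk : k < d) (hN : 2 ^ d ≤ N)
    (W : ℕ → Set (EuclideanSpace ℝ (Fin d)) → ℝ)
    (hSteiner : ∀ A : Set (EuclideanSpace ℝ (Fin d)), IsCompact A → Convex ℝ A →
      A.Nonempty → ∀ ε : ℝ, 0 ≤ ε →
      (volume (A + ε • Metric.closedBall (0 : EuclideanSpace ℝ (Fin d)) 1)).toReal =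
        ∑ j ∈ Finset.range (d + 1), (d.choose j : ℝ) * W j A * ε ^ j)
    (r lam : ℝ) (hlam : 0 < lam) (hr : lam / 2 ≤ r)
    (p q : Fin N → EuclideanSpace ℝ (Fin d))
    (hQ : ∀ i j, i ≠ j → dist (q i) (q j) ≤ lam)
    (hP : ∀ i j, i ≠ j → lam ≤ dist (p i) (p j)) :
    W k (convexHull ℝ (⋃ i, Metric.closedBall (q i) r)) ≤
      W k (convexHull ℝ (⋃ i, Metric.closedBall (p i) r)) := by
  have hd : Module.finrank ℝ (EuclideanSpace ℝ (Fin d)) = d := by simp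
  have : Nontrivial (EuclideanSpace ℝ (Fin d)) :=
    Module.nontrivial_of_finrank_pos (R := ℝ) (hd.symm ▸ hk.pos)
  have : Nonempty (Fin N) := Fin.pos_iff_nonempty.1 (hN.trans_lt' (by positivity))
  have hW : SatisfiesSteinerFormula d W := fun A hA hAc hAn ε hε => by
    rw [← hSteiner A hA hAc hAn ε hε, smul_unitClosedBall_of_nonneg hε, measureReal_def]
  have hr0 : 0 ≤ r := by linarith
  rw [convexHull_iUnion_closedBall, convexHull_iUnion_closedBall]
  have hdist : ∀ i j, dist (q i) (q j) ≤ lam := fun i j => by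
    rcases eq_or_ne i j with rfl | hij
    · rw [dist_self]
      exact hlam.le
    · exact hQ i j hij
  refine le_trans ?_ (le_quermass_of_pow_le_card hW hd (by simpa using hN) hlam.le hr
    (fun i j hij => hP i j hij) hk.le)
  have h := quermass_le_of_dist_le hW hd
    (((finite_range q).isCompact_convexHull ℝ).add (isCompact_closedBall _ _))
    ((convex_convexHull ℝ _).add (convex_closedBall _ _))
    ((range_nonempty q).convexHull.add (Metric.nonempty_closedBall.2 hr0))
    (fun y hy z hz => dist_le_of_mem_convexHull_add_closedBall hdist hy hz) hk.le
  rwa [show (lam + 2 * r) / 2 = r + lam / 2 by ring] at h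
end

section
/- Let d > 1, λ > 0, r > 0, N > 1 and let P = {p_1,...,p_N} ⊂ E^d satisfy |p_i − p_j| ≥ λ for all i < j. Then V_d(∩_{i=1}^N B^d[p_i, r]) ≤ V_d(B^d[o, r − (N^{1/d} − 1)(λ/2)]), where the right-hand side is 0 if r − (N^{1/d} − 1)(λ/2) < 0. -/
open MeasureTheory Set

open scoped ENNReal Topology Pointwise

/-- The one-dimensional Brunn–Minkowski inequality for compact sets. -/
theorem Real.volume_add_volume_le_of_isCompact {A B C : Set ℝ} (hA : IsCompact A)
    (hB : IsCompact B) (hA' : A.Nonempty) (hB' : B.Nonempty)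
    (h : ∀ x ∈ A, ∀ y ∈ B, x + y ∈ C) : volume A + volume B ≤ volume C := by
  obtain ⟨M, hM, hMax⟩ := hA.exists_isGreatest hA'
  obtain ⟨m, hm, hmin⟩ := hB.exists_isLeast hB'
  have hdisj : AEDisjoint volume ((fun x => x + m) '' A) ((fun y => M + y) '' B) := by
    refine measure_mono_null (t := {M + m}) ?_ (by simp)
    rintro _ ⟨⟨x, hx, rfl⟩, ⟨y, hy, hxy⟩⟩
    have h1 := hMax hx
    have h2 := hmin hy
    simp only [mem_singleton_iff] at hxy ⊢
    linarith
  have hmeas : NullMeasurableSet ((fun y => M + y) '' B) volume :=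
    (hB.image (by fun_prop)).measurableSet.nullMeasurableSet
  have hsub : ((fun x => x + m) '' A) ∪ ((fun y => M + y) '' B) ⊆ C := by
    rintro _ (⟨x, hx, rfl⟩ | ⟨y, hy, rfl⟩)
    exacts [h x hx m hm, h M hM y hy]
  calc volume A + volume B
      = volume ((fun x => x + m) '' A) + volume ((fun y => M + y) '' B) := by simp
    _ = volume (((fun x => x + m) '' A) ∪ ((fun y => M + y) '' B)) :=
      (measure_union₀ hmeas hdisj).symm
    _ ≤ volume C := measure_mono hsub

/-- The one-dimensional Brunn–Minkowski inequality for measurable sets. -/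
theorem Real.volume_add_volume_le {A B C : Set ℝ} (hA : MeasurableSet A)
    (hB : MeasurableSet B) (hA' : A.Nonempty) (hB' : B.Nonempty)
    (h : ∀ x ∈ A, ∀ y ∈ B, x + y ∈ C) : volume A + volume B ≤ volume C := by
  obtain ⟨x₀, hx₀⟩ := hA'
  obtain ⟨y₀, hy₀⟩ := hB'
  rw [hA.measure_eq_iSup_isCompact, hB.measure_eq_iSup_isCompact]
  simp only [iSup_and']
  refine ENNReal.biSup_add_biSup_le' (p := fun K => K ⊆ A ∧ IsCompact K)
    (q := fun K => K ⊆ B ∧ IsCompact K) ⟨∅, by simp⟩ ⟨∅, by simp⟩ fun K hK L hL => ?_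
  calc volume K + volume L ≤ volume (insert x₀ K) + volume (insert y₀ L) := by
        gcongr <;> exact subset_insert _ _
    _ ≤ volume C := Real.volume_add_volume_le_of_isCompact (hK.2.insert x₀) (hL.2.insert y₀)
        (insert_nonempty _ _) (insert_nonempty _ _) fun x hx y hy =>
          h x (insert_subset hx₀ hK.1 hx) y (insert_subset hy₀ hL.1 hy)

theorem ENNReal.geom_mean_le_arith_mean2_weighted {a b : ℝ} (ha : 0 < a) (hb : 0 < b)
    (hab : a + b = 1) (x y : ℝ≥0∞) :
    x ^ a * y ^ b ≤ ENNReal.ofReal a * x + ENNReal.ofReal b * y := by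
  have hpq : (a⁻¹).HolderConjugate b⁻¹ := by
    rw [Real.holderConjugate_iff]
    exact ⟨(one_lt_inv₀ ha).2 (by linarith), by simpa⟩
  have := ENNReal.young_inequality (x ^ a) (y ^ b) hpq
  rwa [← ENNReal.rpow_mul, ← ENNReal.rpow_mul, mul_inv_cancel₀ ha.ne', mul_inv_cancel₀ hb.ne',
    ENNReal.rpow_one, ENNReal.rpow_one, ENNReal.ofReal_inv_of_pos ha,
    ENNReal.ofReal_inv_of_pos hb, ENNReal.div_eq_inv_mul, ENNReal.div_eq_inv_mul, inv_inv,
    inv_inv] at this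

theorem lintegral_eq_lintegral_meas_ofReal_lt {α : Type*} [MeasurableSpace α] (μ : Measure α)
    {f : α → ℝ≥0∞} (hf : Measurable f) (hf' : ∀ x, f x ≠ ∞) :
    ∫⁻ x, f x ∂μ = ∫⁻ s in Ioi (0 : ℝ), μ {x | ENNReal.ofReal s < f x} := by
  have := lintegral_eq_lintegral_meas_lt μ (f := fun x => (f x).toReal)
    (.of_forall fun _ => ENNReal.toReal_nonneg) hf.ennreal_toReal.aemeasurable
  simp only [ENNReal.ofReal_toReal (hf' _)] at this
  rw [this]
  refine setLIntegral_congr_fun measurableSet_Ioi fun s hs => ?_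
  congr 1
  ext x
  exact (ENNReal.ofReal_lt_iff_lt_toReal (le_of_lt hs) (hf' x)).symm

/-- The one-dimensional Prékopa–Leindler inequality, in arithmetic form, for functions with
supremum `1`. -/
theorem Real.arith_lintegral_le_of_iSup_eq_one {a b : ℝ} (ha : 0 < a) (hb : 0 < b)
    (hab : a + b = 1) {f g h : ℝ → ℝ≥0∞} (hf : Measurable f) (hg : Measurable g)
    (hh : Measurable h) (hf1 : ⨆ x, f x = 1) (hg1 : ⨆ x, g x = 1)
    (H : ∀ x y, f x ^ a * g y ^ b ≤ h (a * x + b * y)) :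
    ENNReal.ofReal a * (∫⁻ x, f x) + ENNReal.ofReal b * (∫⁻ x, g x) ≤ ∫⁻ x, h x := by
  have hf2 (x) : f x ≤ 1 := hf1 ▸ le_iSup f x
  have hg2 (x) : g x ≤ 1 := hg1 ▸ le_iSup g x
  calc _ ≤ ∫⁻ x, min (h x) 1 := ?_
    _ ≤ ∫⁻ x, h x := lintegral_mono fun x => min_le_left _ _
  rw [lintegral_eq_lintegral_meas_ofReal_lt _ hf fun x => ((hf2 x).trans_lt ENNReal.one_lt_top).ne,
    lintegral_eq_lintegral_meas_ofReal_lt _ hg fun x => ((hg2 x).trans_lt ENNReal.one_lt_top).ne,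
    lintegral_eq_lintegral_meas_ofReal_lt _ (hh.min measurable_const)
      fun x => ((min_le_right _ _).trans_lt ENNReal.one_lt_top).ne,
    ← lintegral_const_mul' _ _ ENNReal.ofReal_ne_top,
    ← lintegral_const_mul' _ _ ENNReal.ofReal_ne_top, ← lintegral_add_left]
  · refine lintegral_mono fun s => ?_
    rcases le_or_gt 1 (ENNReal.ofReal s) with hs | hs
    · have h1 : {x | ENNReal.ofReal s < f x} = ∅ :=
        eq_empty_of_forall_notMem fun x hx => ((hf2 x).trans hs).not_gt hx
      have h2 : {x | ENNReal.ofReal s < g x} = ∅ :=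
        eq_empty_of_forall_notMem fun x hx => ((hg2 x).trans hs).not_gt hx
      simp [h1, h2]
    · have hfn : {x | ENNReal.ofReal s < f x}.Nonempty := lt_iSup_iff.1 (hs.trans_eq hf1.symm)
      have hgn : {x | ENNReal.ofReal s < g x}.Nonempty := lt_iSup_iff.1 (hs.trans_eq hg1.symm)
      have := Real.volume_add_volume_le (C := {x | ENNReal.ofReal s < min (h x) 1})
        ((measurableSet_lt measurable_const hf).const_smul₀ a)
        ((measurableSet_lt measurable_const hg).const_smul₀ b) hfn.smul_set hgn.smul_set ?_
      · simpa [Measure.addHaar_smul, abs_of_pos ha, abs_of_pos hb] using this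
      · rintro _ ⟨x, hx, rfl⟩ _ ⟨y, hy, rfl⟩
        refine lt_min (lt_of_lt_of_le ?_ (H x y)) hs
        calc ENNReal.ofReal s = ENNReal.ofReal s ^ a * ENNReal.ofReal s ^ b := by
              rw [← ENNReal.rpow_add_of_nonneg _ _ ha.le hb.le, hab, ENNReal.rpow_one]
          _ < f x ^ a * g y ^ b :=
            ENNReal.mul_lt_mul (ENNReal.rpow_lt_rpow hx ha) (ENNReal.rpow_lt_rpow hy hb)
  · refine Measurable.const_mul (Antitone.measurable fun s t hst => measure_mono ?_) _
    exact fun x hx => (ENNReal.ofReal_le_ofReal hst).trans_lt hx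

/-- The one-dimensional Prékopa–Leindler inequality for bounded functions. -/
theorem Real.prekopa_leindler_of_iSup_ne_top {a b : ℝ} (ha : 0 < a) (hb : 0 < b)
    (hab : a + b = 1) {f g h : ℝ → ℝ≥0∞} (hf : Measurable f) (hg : Measurable g)
    (hh : Measurable h) (hf1 : ⨆ x, f x ≠ ∞) (hg1 : ⨆ x, g x ≠ ∞)
    (H : ∀ x y, f x ^ a * g y ^ b ≤ h (a * x + b * y)) :
    (∫⁻ x, f x) ^ a * (∫⁻ x, g x) ^ b ≤ ∫⁻ x, h x := by
  set S := ⨆ x, f x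
  set T := ⨆ x, g x
  rcases eq_or_ne S 0 with hS0 | hS0
  · have : ∀ x, f x = 0 := by simpa [S] using hS0
    simp [this, ha]
  rcases eq_or_ne T 0 with hT0 | hT0
  · have : ∀ x, g x = 0 := by simpa [T] using hT0
    simp [this, hb]
  have key := Real.arith_lintegral_le_of_iSup_eq_one ha hb hab (hf.const_mul S⁻¹)
    (hg.const_mul T⁻¹) (hh.const_mul (S⁻¹ ^ a * T⁻¹ ^ b))
    (by rw [← ENNReal.mul_iSup, ENNReal.inv_mul_cancel hS0 hf1])
    (by rw [← ENNReal.mul_iSup, ENNReal.inv_mul_cancel hT0 hg1])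
    (fun x y => by
      rw [ENNReal.mul_rpow_of_nonneg _ _ ha.le, ENNReal.mul_rpow_of_nonneg _ _ hb.le,
        mul_mul_mul_comm]
      gcongr
      exact H x y)
  have := (ENNReal.geom_mean_le_arith_mean2_weighted ha hb hab _ _).trans key
  rw [lintegral_const_mul _ hf, lintegral_const_mul _ hg, lintegral_const_mul _ hh,
    ENNReal.mul_rpow_of_nonneg _ _ ha.le, ENNReal.mul_rpow_of_nonneg _ _ hb.le,
    mul_mul_mul_comm] at this
  refine (ENNReal.mul_le_mul_iff_right ?_ ?_).1 this
  · simp [ha, hb, hf1, hg1, ENNReal.rpow_eq_zero_iff, hS0, hT0]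
  · refine ENNReal.mul_ne_top ?_ ?_ <;> refine ENNReal.rpow_ne_top_of_nonneg (by positivity) ?_ <;>
      simpa

theorem tendsto_lintegral_min_natCast {α : Type*} [MeasurableSpace α] (μ : Measure α)
    {f : α → ℝ≥0∞} (hf : Measurable f) :
    Filter.Tendsto (fun n : ℕ => ∫⁻ x, min (f x) n ∂μ) Filter.atTop (𝓝 (∫⁻ x, f x ∂μ)) := by
  refine lintegral_tendsto_of_tendsto_of_monotone
    (fun n => (hf.min measurable_const).aemeasurable)
    (.of_forall fun x m n hmn => by dsimp only; gcongr) (.of_forall fun x => ?_)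
  simpa using tendsto_const_nhds.min ENNReal.tendsto_nat_nhds_top

/-- The one-dimensional **Prékopa–Leindler inequality**. -/
theorem Real.prekopa_leindler {a b : ℝ} (ha : 0 < a) (hb : 0 < b)
    (hab : a + b = 1) {f g h : ℝ → ℝ≥0∞} (hf : Measurable f) (hg : Measurable g)
    (hh : Measurable h) (H : ∀ x y, f x ^ a * g y ^ b ≤ h (a * x + b * y)) :
    (∫⁻ x, f x) ^ a * (∫⁻ x, g x) ^ b ≤ ∫⁻ x, h x := by
  rcases eq_or_ne (∫⁻ x, f x) 0 with hf0 | hf0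
  · simp [hf0, ha]
  rcases eq_or_ne (∫⁻ x, g x) 0 with hg0 | hg0
  · simp [hg0, hb]
  refine le_of_tendsto (ENNReal.Tendsto.mul
    ((tendsto_lintegral_min_natCast volume hf).ennrpow_const a) ?_
    ((tendsto_lintegral_min_natCast volume hg).ennrpow_const b) ?_) (.of_forall fun n => ?_)
  · exact .inl (by simp [ENNReal.rpow_eq_zero_iff, hf0, ha.not_gt])
  · exact .inl (by simp [ENNReal.rpow_eq_zero_iff, hg0, hb.not_gt])
  refine Real.prekopa_leindler_of_iSup_ne_top ha hb hab (hf.min measurable_const)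
    (hg.min measurable_const) hh ?_ ?_ fun x y => le_trans ?_ (H x y)
  · exact ((iSup_le fun x => min_le_right _ _).trans_lt (ENNReal.natCast_lt_top n)).ne
  · exact ((iSup_le fun x => min_le_right _ _).trans_lt (ENNReal.natCast_lt_top n)).ne
  · gcongr <;> exact min_le_left _ _

/-- The **Prékopa–Leindler inequality** on `Fin n → ℝ`. -/
theorem prekopa_leindler_pi {a b : ℝ} (ha : 0 < a) (hb : 0 < b) (hab : a + b = 1) {n : ℕ}
    {f g h : (Fin n → ℝ) → ℝ≥0∞} (hf : Measurable f) (hg : Measurable g)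
    (hh : Measurable h) (H : ∀ x y, f x ^ a * g y ^ b ≤ h (a • x + b • y)) :
    (∫⁻ x, f x) ^ a * (∫⁻ x, g x) ^ b ≤ ∫⁻ x, h x := by
  induction n with
  | zero =>
    have hvol : volume (univ : Set (Fin 0 → ℝ)) = 1 := by simp [volume_pi]
    simp only [lintegral_unique, hvol, mul_one]
    exact (H _ _).trans_eq (congrArg h (Subsingleton.elim _ _))
  | succ n ih =>
    let e := (MeasurableEquiv.piFinSuccAbove (fun _ : Fin (n + 1) => ℝ) 0).symm
    have he : MeasurePreserving e volume volume :=
      (volume_preserving_piFinSuccAbove (fun _ : Fin (n + 1) => ℝ) 0).symm _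
    have hadd (s t : ℝ) (x y : Fin n → ℝ) :
        e (a * s + b * t, a • x + b • y) = a • e (s, x) + b • e (t, y) := by
      ext i
      refine Fin.cases ?_ (fun i => ?_) i <;>
        simp [e, MeasurableEquiv.piFinSuccAbove_symm_apply, Fin.insertNthEquiv]
    have hint {u : (Fin (n + 1) → ℝ) → ℝ≥0∞} (hu : Measurable u) :
        ∫⁻ x, u x = ∫⁻ s, ∫⁻ x, u (e (s, x)) := by
      rw [← he.lintegral_comp hu, Measure.volume_eq_prod,
        lintegral_prod (fun z => u (e z)) (hu.comp e.measurable).aemeasurable]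
    have hmeas {u : (Fin (n + 1) → ℝ) → ℝ≥0∞} (hu : Measurable u) :
        Measurable fun s => ∫⁻ x, u (e (s, x)) :=
      (hu.comp e.measurable).lintegral_prod_right'
    rw [hint hf, hint hg, hint hh]
    refine Real.prekopa_leindler ha hb hab (hmeas hf) (hmeas hg) (hmeas hh) fun s t => ?_
    have hslice {u : (Fin (n + 1) → ℝ) → ℝ≥0∞} (hu : Measurable u) (s : ℝ) :
        Measurable fun x => u (e (s, x)) :=
      hu.comp (e.measurable.comp measurable_prodMk_left)
    refine ih (hslice hf s) (hslice hg t) (hslice hh _) fun x y => ?_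
    rw [hadd]
    exact H _ _

/-- The **Prékopa–Leindler inequality** on Euclidean space. -/
theorem EuclideanSpace.prekopa_leindler {a b : ℝ} (ha : 0 < a) (hb : 0 < b) (hab : a + b = 1)
    {n : ℕ} {f g h : EuclideanSpace ℝ (Fin n) → ℝ≥0∞} (hf : Measurable f) (hg : Measurable g)
    (hh : Measurable h) (H : ∀ x y, f x ^ a * g y ^ b ≤ h (a • x + b • y)) :
    (∫⁻ x, f x) ^ a * (∫⁻ x, g x) ^ b ≤ ∫⁻ x, h x := by
  have he := PiLp.volume_preserving_toLp (Fin n)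
  rw [← he.lintegral_comp hf, ← he.lintegral_comp hg, ← he.lintegral_comp hh]
  exact prekopa_leindler_pi ha hb hab (hf.comp he.measurable) (hg.comp he.measurable)
    (hh.comp he.measurable) fun x y => H _ _

/-- The multiplicative form of the Brunn–Minkowski inequality. -/
theorem EuclideanSpace.volume_rpow_mul_volume_rpow_le {a b : ℝ} (ha : 0 < a) (hb : 0 < b)
    (hab : a + b = 1) {n : ℕ} {A B C : Set (EuclideanSpace ℝ (Fin n))} (hA : MeasurableSet A)
    (hB : MeasurableSet B) (hC : MeasurableSet C) (H : ∀ x ∈ A, ∀ y ∈ B, a • x + b • y ∈ C) :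
    volume A ^ a * volume B ^ b ≤ volume C := by
  have := EuclideanSpace.prekopa_leindler ha hb hab (measurable_one.indicator hA)
    (measurable_one.indicator hB) (measurable_one.indicator hC) fun x y => ?_
  · simpa [lintegral_indicator_one, hA, hB, hC] using this
  · by_cases hx : x ∈ A
    · by_cases hy : y ∈ B
      · simp [hx, hy, H x hx y hy]
      · simp [hy, hb]
    · simp [hx, ha]

/-- The **Brunn–Minkowski inequality** on Euclidean space. -/
theorem EuclideanSpace.brunn_minkowski {d : ℕ} (hd : d ≠ 0)
    {A B C : Set (EuclideanSpace ℝ (Fin d))} (hA : MeasurableSet A) (hB : MeasurableSet B)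
    (hC : MeasurableSet C) (hA' : A.Nonempty) (hB' : B.Nonempty)
    (H : ∀ x ∈ A, ∀ y ∈ B, x + y ∈ C) :
    volume A ^ (1 / (d : ℝ)) + volume B ^ (1 / (d : ℝ)) ≤ volume C ^ (1 / (d : ℝ)) := by
  have hd' : 0 < 1 / (d : ℝ) := by positivity
  have hAC : volume A ≤ volume C := by
    obtain ⟨y, hy⟩ := hB'
    rw [← measure_preimage_add_right volume y C]
    exact measure_mono fun x hx => H x hx y hy
  have hBC : volume B ≤ volume C := by
    obtain ⟨x, hx⟩ := hA'
    rw [← measure_preimage_add volume x C]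
    exact measure_mono fun y hy => H x hx y hy
  rcases eq_or_ne (volume A) 0 with hA0 | hA0
  · rw [hA0, ENNReal.zero_rpow_of_pos hd', zero_add]
    gcongr
  rcases eq_or_ne (volume B) 0 with hB0 | hB0
  · rw [hB0, ENNReal.zero_rpow_of_pos hd', add_zero]
    gcongr
  rcases eq_or_ne (volume C) ∞ with hCt | hCt
  · rw [hCt, ENNReal.top_rpow_of_pos hd']
    exact le_top
  have hAt := ne_top_of_le_ne_top hCt hAC
  have hBt := ne_top_of_le_ne_top hCt hBC
  obtain ⟨α, hα, hAα⟩ : ∃ α : ℝ, 0 < α ∧ volume A = ENNReal.ofReal (α ^ d) := by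
    refine ⟨(volume A).toReal ^ (d : ℝ)⁻¹,
      Real.rpow_pos_of_pos (ENNReal.toReal_pos hA0 hAt) _, ?_⟩
    rw [Real.rpow_inv_natCast_pow ENNReal.toReal_nonneg hd, ENNReal.ofReal_toReal hAt]
  obtain ⟨β, hβ, hBβ⟩ : ∃ β : ℝ, 0 < β ∧ volume B = ENNReal.ofReal (β ^ d) := by
    refine ⟨(volume B).toReal ^ (d : ℝ)⁻¹,
      Real.rpow_pos_of_pos (ENNReal.toReal_pos hB0 hBt) _, ?_⟩
    rw [Real.rpow_inv_natCast_pow ENNReal.toReal_nonneg hd, ENNReal.ofReal_toReal hBt]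
  have hroot {x : ℝ} (hx : 0 ≤ x) : ENNReal.ofReal (x ^ d) ^ (1 / (d : ℝ)) = ENNReal.ofReal x := by
    rw [ENNReal.ofReal_rpow_of_nonneg (by positivity) hd'.le, one_div,
      Real.pow_rpow_inv_natCast hx hd]
  have hscale {x : ℝ} (hx : 0 < x) {S : Set (EuclideanSpace ℝ (Fin d))}
      (hS : volume S = ENNReal.ofReal (x ^ d)) :
      volume ((fun z => (x / (α + β)) • z) ⁻¹' S) = ENNReal.ofReal ((α + β) ^ d) := by
    rw [Measure.addHaar_preimage_smul _ (by positivity), hS, finrank_euclideanSpace_fin,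
      abs_of_pos (by positivity), ← ENNReal.ofReal_mul (by positivity), div_pow]
    congr 1
    field_simp
  have hab : α / (α + β) + β / (α + β) = 1 := by field_simp
  have key := EuclideanSpace.volume_rpow_mul_volume_rpow_le (a := α / (α + β))
    (b := β / (α + β)) (by positivity) (by positivity) hab
    (hA.preimage (measurable_const_smul _)) (hB.preimage (measurable_const_smul _)) hC
    fun x hx y hy => H _ hx _ hy
  rw [hscale hα hAα, hscale hβ hBβ,
    ← ENNReal.rpow_add_of_nonneg _ _ (by positivity) (by positivity), hab,
    ENNReal.rpow_one] at key
  rw [hAα, hBβ, hroot hα.le, hroot hβ.le, ← ENNReal.ofReal_add hα.le hβ.le,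
    ← hroot (add_pos hα hβ).le]
  gcongr

/-- If `N > 1` points in Euclidean `d`-space have pairwise distances at
least `λ`, then `V(⋂ᵢ B^d[pᵢ, r]) ≤ V(B^d[o, r − (N^{1/d} − 1)·(λ/2)])` (a closed ball of
negative radius being empty). -/
theorem euclidean_intersection_volume_upper_bound
    (d N : ℕ) (hd : 1 < d) (hN : 1 < N)
    (r lam : ℝ) (hlam : 0 < lam) (hr : 0 < r)
    (p : Fin N → EuclideanSpace ℝ (Fin d))
    (hP : ∀ i j, i ≠ j → lam ≤ dist (p i) (p j)) :
    volume (⋂ i, Metric.closedBall (p i) r) ≤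
      volume (Metric.closedBall (0 : EuclideanSpace ℝ (Fin d))
        (r - ((N : ℝ) ^ (1 / (d : ℝ)) - 1) * (lam / 2))) := by
  have hd0 : d ≠ 0 := by lia
  have hd' : 0 < 1 / (d : ℝ) := by positivity
  set X := ⋂ i, Metric.closedBall (p i) r
  rcases X.eq_empty_or_nonempty with hXe | hXn
  · simp [hXe]
  have hXm : MeasurableSet X := .iInter fun _ => Metric.isClosed_closedBall.measurableSet
  have hmem {x : EuclideanSpace ℝ (Fin d)} (hx : x ∈ X) (i : Fin N) : dist x (p i) ≤ r :=
    mem_iInter.1 hx i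
  set κ := volume (Metric.ball (0 : EuclideanSpace ℝ (Fin d)) 1) with hκ
  have hκt : κ ^ (1 / (d : ℝ)) ≠ ∞ :=
    ENNReal.rpow_ne_top_of_nonneg hd'.le measure_ball_lt_top.ne
  have : Nonempty (Fin d) := ⟨⟨0, by lia⟩⟩
  have hroot {s : ℝ} (hs : 0 ≤ s) : (ENNReal.ofReal (s ^ d) * κ) ^ (1 / (d : ℝ)) =
      ENNReal.ofReal s * κ ^ (1 / (d : ℝ)) := by
    rw [ENNReal.mul_rpow_of_nonneg _ _ hd'.le, ENNReal.ofReal_rpow_of_nonneg (by positivity) hd'.le,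
      one_div, Real.pow_rpow_inv_natCast hs hd0]
  have hpack : volume (⋃ i, Metric.ball (p i) (lam / 2)) =
      N * (ENNReal.ofReal ((lam / 2) ^ d) * κ) := by
    rw [measure_iUnion (fun i j hij => Metric.ball_disjoint_ball (by linarith [hP i j hij]))
      fun _ => Metric.isOpen_ball.measurableSet]
    simp [Measure.addHaar_ball _ _ (half_pos hlam).le, hκ]
  have key := EuclideanSpace.brunn_minkowski hd0
    (A := ⋃ i, Metric.ball (p i) (lam / 2)) (B := -X) (C := Metric.closedBall 0 (r + lam / 2))
    (.iUnion fun _ => Metric.isOpen_ball.measurableSet) hXm.neg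
    Metric.isClosed_closedBall.measurableSet
    ⟨p ⟨0, by lia⟩, mem_iUnion.2 ⟨_, Metric.mem_ball_self (half_pos hlam)⟩⟩ hXn.neg
    fun x hx y hy => by
      obtain ⟨i, hi⟩ := mem_iUnion.1 hx
      have h1 := hmem hy i
      have h2 := dist_triangle x (p i) (-y)
      rw [dist_comm (p i), dist_eq_norm x (-y), sub_neg_eq_add] at h2
      rw [mem_closedBall_zero_iff]
      linarith [Metric.mem_ball.1 hi]
  have hNd : (N : ℝ≥0∞) ^ (1 / (d : ℝ)) = ENNReal.ofReal ((N : ℝ) ^ (1 / (d : ℝ))) := by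
    rw [← ENNReal.ofReal_rpow_of_nonneg (by positivity) hd'.le, ENNReal.ofReal_natCast]
  rw [hpack, Measure.measure_neg, ENNReal.mul_rpow_of_nonneg _ _ hd'.le, hroot (by positivity),
    Measure.addHaar_closedBall _ _ (by positivity), finrank_euclideanSpace_fin, ← hκ,
    hroot (by positivity), hNd, ← mul_assoc, ← ENNReal.ofReal_mul (by positivity)] at key
  have hXle : volume X ^ (1 / (d : ℝ)) ≤
      ENNReal.ofReal (r - ((N : ℝ) ^ (1 / (d : ℝ)) - 1) * (lam / 2)) * κ ^ (1 / (d : ℝ)) := by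
    refine (ENNReal.le_sub_of_add_le_left
      (ENNReal.mul_ne_top ENNReal.ofReal_ne_top hκt) key).trans_eq ?_
    rw [← ENNReal.sub_mul fun _ _ => hκt, ← ENNReal.ofReal_sub _ (by positivity)]
    congr 2
    ring
  rcases lt_or_ge (r - ((N : ℝ) ^ (1 / (d : ℝ)) - 1) * (lam / 2)) 0 with hρ | hρ
  · rw [ENNReal.ofReal_of_nonpos hρ.le, zero_mul, nonpos_iff_eq_zero,
      ENNReal.rpow_eq_zero_iff_of_pos hd'] at hXle
    simp [hXle]
  · rw [Measure.addHaar_closedBall _ _ hρ, finrank_euclideanSpace_fin, ← hκ]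
    rwa [← hroot hρ, ENNReal.rpow_le_rpow_iff hd'] at hXle
end
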